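/- arXiv:2401.01695 — 9 statements merged into one kernel-verified Lean document; each statement's English description precedes it below -/
import Mathlib

section
/- Let Y be a Banach space and let ω be an admissible modulus that additionally satisfies the Dini-type condition [ω]_* := sup_{s>0} (1/ω(s)) ∫_0^s ω(t)/t dt < ∞. Then VMO^ω(ℝ^n,Y) equals the closure of the set of compactly supported C^∞ maps ℝ^n → Y with respect to the BMO^ω(ℝ^n,Y) norm. -/
open Filter Set

/-- An admissible modulus of continuity `ω : (0,∞) → (0,∞)`: positive, non-decreasing,
`ω(t) → 0` as `t → 0⁺`, `ω(t) → ∞` as `t → ∞`, `t/ω(t) → 0` as `t → 0⁺`, and doubling. -/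
def Admissible (ω : ℝ → ℝ) : Prop :=
  (∀ t : ℝ, 0 < t → 0 < ω t) ∧
  (∀ s t : ℝ, 0 < s → s ≤ t → ω s ≤ ω t) ∧
  Tendsto ω (nhdsWithin 0 (Ioi 0)) (nhds 0) ∧
  Tendsto ω atTop atTop ∧
  Tendsto (fun t => t / ω t) (nhdsWithin 0 (Ioi 0)) (nhds 0) ∧
  ∃ C : ℝ, 1 < C ∧ ∀ t : ℝ, 0 < t → ω (2 * t) ≤ C * ω t

section Defs

variable {X Y : Type*} [NormedAddCommGroup X] [NormedSpace ℝ X]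
  [NormedAddCommGroup Y] [NormedSpace ℝ Y]

/-- `‖f‖_{Ċ^{0,ω}} ≤ M`. -/
def HolderLE (ω : ℝ → ℝ) (f : X → Y) (M : ℝ) : Prop :=
  ∀ x y : X, x ≠ y → ‖f x - f y‖ ≤ M * ω ‖x - y‖

/-- `f ∈ Ċ^{0,ω}(X,Y)`: the homogeneous Hölder seminorm is finite. -/
def HolderFinite (ω : ℝ → ℝ) (f : X → Y) : Prop :=
  ∃ M : ℝ, HolderLE ω f M

/-- `f ∈ VC^{0,ω}_small(X,Y)`. -/
def VCsmall (ω : ℝ → ℝ) (f : X → Y) : Prop :=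
  HolderFinite ω f ∧
    ∀ ε : ℝ, 0 < ε → ∃ δ : ℝ, 0 < δ ∧ ∀ x y : X, x ≠ y → ‖x - y‖ < δ →
      ‖f x - f y‖ ≤ ε * ω ‖x - y‖

/-- `f ∈ VC^{0,ω}_large(X,Y)`. -/
def VClarge (ω : ℝ → ℝ) (f : X → Y) : Prop :=
  HolderFinite ω f ∧
    ∀ ε : ℝ, 0 < ε → ∃ δ : ℝ, 0 < δ ∧ ∀ x y : X, δ < ‖x - y‖ →
      ‖f x - f y‖ ≤ ε * ω ‖x - y‖

/-- `f ∈ VC^{0,ω}_far(X,Y)`. -/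
def VCfar (ω : ℝ → ℝ) (f : X → Y) : Prop :=
  HolderFinite ω f ∧
    ∀ ε : ℝ, 0 < ε → ∃ δ : ℝ, 0 < δ ∧ ∀ x y : X, x ≠ y → δ < ‖x‖ → δ < ‖y‖ →
      ‖f x - f y‖ ≤ ε * ω ‖x - y‖

/-- `f ∈ VC^{0,ω}(X,Y)`, the intersection of the three vanishing classes. -/
def VCfull (ω : ℝ → ℝ) (f : X → Y) : Prop :=
  VCsmall ω f ∧ VClarge ω f ∧ VCfar ω f

/-- `f` has bounded support: it vanishes outside some bounded set. -/
def BddSupp (f : X → Y) : Prop :=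
  ∃ R : ℝ, ∀ x : X, R < ‖x‖ → f x = 0

end Defs

section BMO

open MeasureTheory

variable {n : ℕ} {Y : Type*} [NormedAddCommGroup Y] [NormedSpace ℝ Y]

/-- The closed axis-parallel cube in `ℝⁿ` with lower corner `c` and side length `ℓ`. -/
def cube (c : EuclideanSpace ℝ (Fin n)) (ℓ : ℝ) : Set (EuclideanSpace ℝ (Fin n)) :=
  {y | ∀ i : Fin n, c i ≤ y i ∧ y i ≤ c i + ℓ}

/-- The mean oscillation functional
`𝒪^ω(f;Q) = (1/ω(ℓ(Q))) ⨍_Q ‖f − ⟨f⟩_Q‖` over the cube `Q = cube c ℓ`. -/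
noncomputable def osc (ω : ℝ → ℝ) (f : EuclideanSpace ℝ (Fin n) → Y)
    (c : EuclideanSpace ℝ (Fin n)) (ℓ : ℝ) : ℝ :=
  (1 / ω ℓ) * ⨍ y in cube c ℓ, ‖f y - ⨍ z in cube c ℓ, f z‖

/-- `‖f‖_{BMO^ω} ≤ M`: all mean oscillations are bounded by `M`. -/
def BMOLE (ω : ℝ → ℝ) (f : EuclideanSpace ℝ (Fin n) → Y) (M : ℝ) : Prop :=
  ∀ (c : EuclideanSpace ℝ (Fin n)) (ℓ : ℝ), 0 < ℓ → osc ω f c ℓ ≤ M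

end BMO

section VMO

open MeasureTheory

variable {n : ℕ} {Y : Type*} [NormedAddCommGroup Y] [NormedSpace ℝ Y]

/-- `f ∈ VMO^ω_small(ℝⁿ,Y)`. -/
def VMOsmall (ω : ℝ → ℝ) (f : EuclideanSpace ℝ (Fin n) → Y) : Prop :=
  (∃ M : ℝ, BMOLE ω f M) ∧
    ∀ ε : ℝ, 0 < ε → ∃ δ : ℝ, 0 < δ ∧
      ∀ (c : EuclideanSpace ℝ (Fin n)) (ℓ : ℝ), 0 < ℓ → ℓ < δ → osc ω f c ℓ ≤ ε

/-- `f ∈ VMO^ω_large(ℝⁿ,Y)`. -/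
def VMOlarge (ω : ℝ → ℝ) (f : EuclideanSpace ℝ (Fin n) → Y) : Prop :=
  (∃ M : ℝ, BMOLE ω f M) ∧
    ∀ ε : ℝ, 0 < ε → ∃ δ : ℝ, 0 < δ ∧
      ∀ (c : EuclideanSpace ℝ (Fin n)) (ℓ : ℝ), 0 < ℓ → δ < ℓ → osc ω f c ℓ ≤ ε

/-- `f ∈ VMO^ω_far(ℝⁿ,Y)`. -/
def VMOfar (ω : ℝ → ℝ) (f : EuclideanSpace ℝ (Fin n) → Y) : Prop :=
  (∃ M : ℝ, BMOLE ω f M) ∧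
    ∀ ε : ℝ, 0 < ε → ∃ δ : ℝ, 0 < δ ∧
      ∀ (c : EuclideanSpace ℝ (Fin n)) (ℓ : ℝ), 0 < ℓ →
        δ < Metric.infDist (0 : EuclideanSpace ℝ (Fin n)) (cube c ℓ) → osc ω f c ℓ ≤ ε

/-- `f ∈ VMO^ω(ℝⁿ,Y)`, the intersection of the three vanishing classes. -/
def VMOfull (ω : ℝ → ℝ) (f : EuclideanSpace ℝ (Fin n) → Y) : Prop :=
  VMOsmall ω f ∧ VMOlarge ω f ∧ VMOfar ω f

end VMO

section Cube

open MeasureTheory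

variable {n : ℕ}

lemma cube_eq_preimage_closedBall (c : EuclideanSpace ℝ (Fin n)) {ℓ : ℝ} (hℓ : 0 ≤ ℓ) :
    cube c ℓ = WithLp.ofLp ⁻¹' Metric.closedBall (fun i => c i + ℓ / 2) (ℓ / 2) := by
  ext y
  simp only [cube, mem_ofPred_eq, mem_preimage, Metric.mem_closedBall]
  rw [dist_pi_le_iff (by linarith)]
  refine forall_congr' fun i => ?_
  rw [Real.dist_eq, abs_le]
  constructor <;> rintro ⟨h1, h2⟩ <;> constructor <;> linarith

lemma isClosed_cube (c : EuclideanSpace ℝ (Fin n)) (ℓ : ℝ) : IsClosed (cube c ℓ) := by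
  have : cube c ℓ = ⋂ i, ({y | c i ≤ y i} ∩ {y | y i ≤ c i + ℓ}) := by
    ext y; simp [cube]
  rw [this]
  refine isClosed_iInter fun i => IsClosed.inter ?_ ?_
  · exact isClosed_le (by fun_prop) (by fun_prop)
  · exact isClosed_le (by fun_prop) (by fun_prop)

lemma measurableSet_cube (c : EuclideanSpace ℝ (Fin n)) (ℓ : ℝ) : MeasurableSet (cube c ℓ) :=
  (isClosed_cube c ℓ).measurableSet

lemma norm_sub_le_of_mem_cube {c : EuclideanSpace ℝ (Fin n)} {ℓ : ℝ}
    {x y : EuclideanSpace ℝ (Fin n)} (hx : x ∈ cube c ℓ) (hy : y ∈ cube c ℓ) (hℓ : 0 ≤ ℓ) :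
    ‖x - y‖ ≤ n * ℓ := by
  have h : ∀ i, ‖(x - y) i‖ ≤ ℓ := fun i => by
    have h1 := hx i
    have h2 := hy i
    rw [PiLp.sub_apply, Real.norm_eq_abs, abs_le]
    constructor <;> linarith [h1.1, h1.2, h2.1, h2.2]
  rw [EuclideanSpace.norm_eq]
  refine Real.sqrt_le_iff.2 ⟨by positivity, ?_⟩
  calc ∑ i, ‖(x - y) i‖ ^ 2 ≤ ∑ _i : Fin n, ℓ ^ 2 := by
        gcongr with i
        exact h i
    _ = n * ℓ ^ 2 := by simp
    _ ≤ (n * ℓ) ^ 2 := by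
        rw [mul_pow]
        gcongr
        exact_mod_cast Nat.le_self_pow two_ne_zero n

lemma isCompact_cube (c : EuclideanSpace ℝ (Fin n)) {ℓ : ℝ} (hℓ : 0 ≤ ℓ) :
    IsCompact (cube c ℓ) := by
  refine Metric.isCompact_of_isClosed_isBounded (isClosed_cube c ℓ) ?_
  refine Metric.isBounded_iff.2 ⟨n * ℓ, fun x hx y hy => ?_⟩
  rw [dist_eq_norm]
  exact norm_sub_le_of_mem_cube hx hy hℓ

lemma self_mem_cube (c : EuclideanSpace ℝ (Fin n)) {ℓ : ℝ} (hℓ : 0 ≤ ℓ) : c ∈ cube c ℓ :=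
  fun _ => ⟨le_rfl, by linarith⟩

lemma volume_cube (c : EuclideanSpace ℝ (Fin n)) {ℓ : ℝ} (hℓ : 0 ≤ ℓ) :
    volume (cube c ℓ) = ENNReal.ofReal (ℓ ^ n) := by
  rw [cube_eq_preimage_closedBall c hℓ, (PiLp.volume_preserving_ofLp (Fin n)).measure_preimage
    Metric.isClosed_closedBall.measurableSet.nullMeasurableSet,
    Real.volume_pi_closedBall _ (by linarith)]
  simp [mul_div_cancel₀]

lemma measureReal_cube (c : EuclideanSpace ℝ (Fin n)) {ℓ : ℝ} (hℓ : 0 ≤ ℓ) :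
    volume.real (cube c ℓ) = ℓ ^ n := by
  rw [Measure.real, volume_cube c hℓ, ENNReal.toReal_ofReal (by positivity)]

lemma volume_cube_ne_zero (c : EuclideanSpace ℝ (Fin n)) {ℓ : ℝ} (hℓ : 0 < ℓ) :
    volume (cube c ℓ) ≠ 0 := by
  rw [volume_cube c hℓ.le]
  simpa using pow_pos hℓ n

lemma volume_cube_ne_top (c : EuclideanSpace ℝ (Fin n)) {ℓ : ℝ} (hℓ : 0 ≤ ℓ) :
    volume (cube c ℓ) ≠ ⊤ := by
  rw [volume_cube c hℓ]
  simp

/-- The image of `cube c ℓ` under the homothety of ratio `2⁻ᵏ` centred at `x` is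
`cube (shrink x c k) (ℓ / 2 ^ k)`. -/
noncomputable def shrink (x c : EuclideanSpace ℝ (Fin n)) (k : ℕ) : EuclideanSpace ℝ (Fin n) :=
  x + (1 / 2 ^ k : ℝ) • (c - x)

lemma shrink_apply (x c : EuclideanSpace ℝ (Fin n)) (k : ℕ) (i : Fin n) :
    shrink x c k i = x i - (x i - c i) / 2 ^ k := by
  simp only [shrink, PiLp.add_apply, PiLp.smul_apply, PiLp.sub_apply, smul_eq_mul]
  ring

@[simp] lemma shrink_zero (x c : EuclideanSpace ℝ (Fin n)) : shrink x c 0 = c := by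
  simp [shrink]

lemma shrink_succ (x c : EuclideanSpace ℝ (Fin n)) (k : ℕ) :
    shrink x c (k + 1) = shrink x (shrink x c k) 1 := by
  ext i
  simp only [shrink_apply]
  ring

lemma mem_cube_shrink {x c : EuclideanSpace ℝ (Fin n)} {ℓ : ℝ} (hx : x ∈ cube c ℓ) (k : ℕ) :
    x ∈ cube (shrink x c k) (ℓ / 2 ^ k) := by
  intro i
  obtain ⟨h1, h2⟩ := hx i
  rw [shrink_apply]
  have h3 : 0 ≤ (x i - c i) / 2 ^ k := div_nonneg (by linarith) (by positivity)
  have h4 : (x i - c i) / 2 ^ k ≤ ℓ / 2 ^ k := by gcongr; linarith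
  constructor <;> linarith

lemma cube_shrink_subset {x c : EuclideanSpace ℝ (Fin n)} {ℓ : ℝ} (hx : x ∈ cube c ℓ) (k : ℕ) :
    cube (shrink x c k) (ℓ / 2 ^ k) ⊆ cube c ℓ := by
  intro y hy i
  obtain ⟨h1, h2⟩ := hx i
  obtain ⟨h3, h4⟩ := hy i
  rw [shrink_apply] at h3 h4
  have h0 : (1 : ℝ) ≤ 2 ^ k := one_le_pow₀ (by norm_num)
  have h5 : (x i - c i) / 2 ^ k ≤ x i - c i := div_le_self (by linarith) h0
  have h6 : (c i + ℓ - x i) / 2 ^ k ≤ c i + ℓ - x i := div_le_self (by linarith) h0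
  have h7 : (c i + ℓ - x i) / 2 ^ k = ℓ / 2 ^ k - (x i - c i) / 2 ^ k := by ring
  constructor <;> linarith

lemma exists_cube_mem_mem (x y : EuclideanSpace ℝ (Fin n)) :
    ∃ c, x ∈ cube c ‖x - y‖ ∧ y ∈ cube c ‖x - y‖ := by
  refine ⟨WithLp.toLp 2 fun i => min (x i) (y i), fun i => ?_, fun i => ?_⟩
  all_goals
    have h := PiLp.norm_apply_le (x - y) i
    rw [PiLp.sub_apply, Real.norm_eq_abs, abs_le] at h
    simp only
    constructor
    · simp
    · rcases min_cases (x i) (y i) with ⟨h1, _⟩ | ⟨h1, _⟩ <;> rw [h1] <;> linarith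

end Cube

section Average

open MeasureTheory

variable {n : ℕ} {Y : Type*} [NormedAddCommGroup Y]

lemma MeasureTheory.LocallyIntegrable.integrableOn_cube {f : EuclideanSpace ℝ (Fin n) → Y}
    (hf : LocallyIntegrable f) (c : EuclideanSpace ℝ (Fin n)) {ℓ : ℝ} (hℓ : 0 ≤ ℓ) :
    IntegrableOn f (cube c ℓ) :=
  hf.integrableOn_isCompact (isCompact_cube c hℓ)

variable [NormedSpace ℝ Y] [CompleteSpace Y]

lemma norm_setAverage_cube_sub_le {f : EuclideanSpace ℝ (Fin n) → Y} {c : EuclideanSpace ℝ (Fin n)}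
    {ℓ : ℝ} (hℓ : 0 < ℓ) (hf : IntegrableOn f (cube c ℓ)) (v : Y) :
    ‖(⨍ y in cube c ℓ, f y) - v‖ ≤ ⨍ y in cube c ℓ, ‖f y - v‖ := by
  have hv : IntegrableOn (fun _ => v) (cube c ℓ) :=
    integrableOn_const (volume_cube_ne_top c hℓ.le)
  have h1 : (⨍ y in cube c ℓ, f y) - v = ⨍ y in cube c ℓ, (f y - v) := by
    have : v = ⨍ _y in cube c ℓ, v :=
      (setAverage_const (volume_cube_ne_zero c hℓ) (volume_cube_ne_top c hℓ.le) v).symm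
    conv_lhs => rw [this]
    rw [setAverage_eq, setAverage_eq, setAverage_eq, integral_sub hf hv, smul_sub]
  rw [h1, setAverage_eq, setAverage_eq, norm_smul, smul_eq_mul, norm_inv, Real.norm_eq_abs,
    abs_of_nonneg measureReal_nonneg]
  gcongr
  exact norm_integral_le_integral_norm _

/-- Averages over a cube and a subcube of half the side length are comparable. -/
lemma norm_setAverage_half_sub_le {f : EuclideanSpace ℝ (Fin n) → Y}
    (hf : LocallyIntegrable f) {c c' : EuclideanSpace ℝ (Fin n)}
    {ℓ : ℝ} (hℓ : 0 < ℓ) (hsub : cube c' (ℓ / 2) ⊆ cube c ℓ) (v : Y) :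
    ‖(⨍ y in cube c' (ℓ / 2), f y) - v‖ ≤ 2 ^ n * ⨍ y in cube c ℓ, ‖f y - v‖ := by
  refine (norm_setAverage_cube_sub_le (half_pos hℓ)
    (hf.integrableOn_cube c' (half_pos hℓ).le) v).trans ?_
  rw [setAverage_eq, setAverage_eq, measureReal_cube _ hℓ.le, measureReal_cube _ (half_pos hℓ).le,
    smul_eq_mul, smul_eq_mul, ← mul_assoc]
  have : 2 ^ n * (ℓ ^ n)⁻¹ = ((ℓ / 2) ^ n)⁻¹ := by
    rw [div_pow, inv_div, div_eq_mul_inv]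
  rw [this]
  gcongr
  · exact Eventually.of_forall fun _ => norm_nonneg _
  · exact ((hf.integrableOn_cube c hℓ.le).sub
      (integrableOn_const (volume_cube_ne_top c hℓ.le))).norm

/-- Averages over the homothetic images of a cube containing `x` converge to `f x` for almost
every `x`. -/
lemma ae_tendsto_setAverage_shrink {f : EuclideanSpace ℝ (Fin n) → Y}
    (hf : LocallyIntegrable f) :
    ∀ᵐ x : EuclideanSpace ℝ (Fin n), ∀ (c : EuclideanSpace ℝ (Fin n)) (ℓ : ℝ), 0 < ℓ →
      x ∈ cube c ℓ →
      Tendsto (fun k : ℕ => ⨍ y in cube (shrink x c k) (ℓ / 2 ^ k), f y) atTop (nhds (f x)) := by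
  have hmp := PiLp.volume_preserving_ofLp (Fin n)
  have hemb : MeasurableEmbedding (WithLp.ofLp : EuclideanSpace ℝ (Fin n) → Fin n → ℝ) :=
    (MeasurableEquiv.toLp 2 (Fin n → ℝ)).symm.measurableEmbedding
  have hf' : LocallyIntegrable (fun y : Fin n → ℝ => f (WithLp.toLp 2 y)) := by
    refine (locallyIntegrable_iff).2 fun K hK => ?_
    rw [← hmp.integrableOn_comp_preimage hemb]
    have : WithLp.ofLp ⁻¹' K = WithLp.toLp 2 '' K := by
      ext y
      exact ⟨fun h => ⟨y.ofLp, h, rfl⟩, by rintro ⟨z, hz, rfl⟩; exact hz⟩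
    rw [this]
    exact hf.integrableOn_isCompact (hK.image (PiLp.continuous_toLp 2 _))
  have key := IsUnifLocDoublingMeasure.ae_tendsto_average volume hf' 1
  filter_upwards [hmp.quasiMeasurePreserving.ae key] with x hx c ℓ hℓ hxc
  have hpos : ∀ k : ℕ, 0 < ℓ / 2 ^ k := fun k => by positivity
  have hlim := hx (l := atTop) (fun k : ℕ => fun i => shrink x c k i + ℓ / 2 ^ k / 2)
    (fun k : ℕ => ℓ / 2 ^ k / 2) ?_ ?_
  · refine hlim.congr fun k => ?_
    rw [setAverage_eq, setAverage_eq, cube_eq_preimage_closedBall _ (hpos k).le,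
      ← hmp.setIntegral_preimage_emb hemb]
    congr 2
    rw [Measure.real, Measure.real,
      hmp.measure_preimage Metric.isClosed_closedBall.measurableSet.nullMeasurableSet]
  · refine tendsto_nhdsWithin_iff.2 ⟨?_, Eventually.of_forall fun k => by
      simpa using half_pos (hpos k)⟩
    have h1 : Tendsto (fun k : ℕ => ℓ / 2 * (1 / 2 : ℝ) ^ k) atTop (nhds (ℓ / 2 * 0)) :=
      (tendsto_pow_atTop_nhds_zero_of_lt_one (by norm_num) (by norm_num)).const_mul _
    rw [mul_zero] at h1
    refine h1.congr fun k => ?_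
    rw [div_pow, one_pow]
    ring
  · refine Eventually.of_forall fun k => ?_
    have h := mem_cube_shrink hxc k
    rw [cube_eq_preimage_closedBall _ (hpos k).le] at h
    rw [one_mul]
    exact h

/-- The mean oscillation of `h` is at most its essential oscillation. -/
lemma setAverage_norm_sub_setAverage_le {h : EuclideanSpace ℝ (Fin n) → Y}
    {G : Set (EuclideanSpace ℝ (Fin n))} (hG : ∀ᵐ x, x ∈ G) {c : EuclideanSpace ℝ (Fin n)}
    {ℓ : ℝ} (hℓ : 0 < ℓ) (hh : IntegrableOn h (cube c ℓ)) {B : ℝ}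
    (hB : ∀ x ∈ G, ∀ y ∈ G, x ∈ cube c ℓ → y ∈ cube c ℓ → ‖h x - h y‖ ≤ B) :
    ⨍ y in cube c ℓ, ‖h y - ⨍ z in cube c ℓ, h z‖ ≤ B := by
  have hmem : ∀ᵐ x ∂(volume.restrict (cube c ℓ)), x ∈ G ∧ x ∈ cube c ℓ :=
    (ae_restrict_of_ae hG).and (ae_restrict_mem (measurableSet_cube c ℓ))
  have h1 : ∀ x ∈ G, x ∈ cube c ℓ → ‖h x - ⨍ z in cube c ℓ, h z‖ ≤ B := by
    intro x hxG hx
    have := (convex_closedBall (h x) B).set_average_mem Metric.isClosed_closedBall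
      (volume_cube_ne_zero c hℓ) (volume_cube_ne_top c hℓ.le) (hmem.mono fun y hy => by
        rw [Metric.mem_closedBall, dist_eq_norm]
        exact hB y hy.1 x hxG hy.2 hx) hh
    rwa [Metric.mem_closedBall, dist_comm, dist_eq_norm] at this
  exact (convex_Iic B).set_average_mem isClosed_Iic
    (volume_cube_ne_zero c hℓ) (volume_cube_ne_top c hℓ.le)
    (hmem.mono fun y hy => h1 y hy.1 hy.2)
    (hh.sub (integrableOn_const (volume_cube_ne_top c hℓ.le))).norm

end Average

section Campanato

open MeasureTheory

variable {ω : ℝ → ℝ}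

/-- The Dini condition controls the dyadic sums of the modulus. -/
lemma Admissible.exists_sum_dyadic_le (hω : Admissible ω)
    (hdini : ∃ D : ℝ, ∀ s : ℝ, 0 < s →
      IntegrableOn (fun t => ω t / t) (Set.Ioc 0 s) ∧
      (∫ t in Set.Ioc (0:ℝ) s, ω t / t) ≤ D * ω s) :
    ∃ K : ℝ, 0 ≤ K ∧ ∀ ℓ : ℝ, 0 < ℓ → ∀ N : ℕ,
      ∑ k ∈ Finset.range N, ω (ℓ / 2 ^ k) ≤ K * ω ℓ := by
  obtain ⟨hpos, hmono, -, -, -, C, hC, hdb⟩ := hω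
  obtain ⟨D, hD⟩ := hdini
  have hC0 : 0 < C := by linarith
  refine ⟨2 * |D| * C, by positivity, fun ℓ hℓ N => ?_⟩
  have hInt : IntegrableOn (fun t => ω t / t) (Ioc 0 (2 * ℓ)) := (hD (2 * ℓ) (by linarith)).1
  have hstep : ∀ a : ℝ, 0 < a → a ≤ ℓ → ω a ≤ 2 * ∫ t in Ioc a (2 * a), ω t / t := by
    intro a ha haℓ
    have h1 : ∫ _t in Ioc a (2 * a), ω a / (2 * a) ≤ ∫ t in Ioc a (2 * a), ω t / t := by
      refine setIntegral_mono_on (integrableOn_const (by simp))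
        (hInt.mono_set (Ioc_subset_Ioc ha.le (by linarith))) measurableSet_Ioc fun t ht => ?_
      have ht0 : 0 < t := ha.trans ht.1
      have := hpos a ha
      exact div_le_div₀ (hpos t ht0).le (hmono a t ha ht.1.le) ht0 ht.2
    rw [setIntegral_const, smul_eq_mul, measureReal_def, Real.volume_Ioc,
      ENNReal.toReal_ofReal (by linarith)] at h1
    have h2 : (2 * a - a) * (ω a / (2 * a)) = ω a / 2 := by
      field_simp
      ring
    linarith
  have hsum : ∀ N : ℕ, ∑ k ∈ Finset.range N, ω (ℓ / 2 ^ k) ≤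
      2 * ∫ t in Ioc (2 * (ℓ / 2 ^ N)) (2 * ℓ), ω t / t := by
    intro N
    induction N with
    | zero => simp
    | succ N ih =>
      have hp : 0 < ℓ / 2 ^ N := by positivity
      have hle : ℓ / 2 ^ N ≤ ℓ := div_le_self hℓ.le (one_le_pow₀ (by norm_num))
      have he : 2 * (ℓ / 2 ^ (N + 1)) = ℓ / 2 ^ N := by
        rw [pow_succ]
        field_simp
      rw [Finset.sum_range_succ, he]
      have hsplit : ∫ t in Ioc (ℓ / 2 ^ N) (2 * ℓ), ω t / t =
          (∫ t in Ioc (ℓ / 2 ^ N) (2 * (ℓ / 2 ^ N)), ω t / t) +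
            ∫ t in Ioc (2 * (ℓ / 2 ^ N)) (2 * ℓ), ω t / t := by
        rw [← setIntegral_union (Set.Ioc_disjoint_Ioc_of_le le_rfl) measurableSet_Ioc
          (hInt.mono_set (Ioc_subset_Ioc hp.le (by linarith)))
          (hInt.mono_set (Ioc_subset_Ioc (by linarith) le_rfl)),
          Ioc_union_Ioc_eq_Ioc (by linarith) (by linarith)]
      have := hstep _ hp hle
      linarith
  have hnn : 0 ≤ᵐ[volume.restrict (Ioc 0 (2 * ℓ))] fun t => ω t / t := by
    filter_upwards [ae_restrict_mem measurableSet_Ioc] with t ht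
    exact div_nonneg (hpos t ht.1).le ht.1.le
  have hω2 : 0 < ω (2 * ℓ) := hpos _ (by linarith)
  calc ∑ k ∈ Finset.range N, ω (ℓ / 2 ^ k)
      ≤ 2 * ∫ t in Ioc (2 * (ℓ / 2 ^ N)) (2 * ℓ), ω t / t := hsum N
    _ ≤ 2 * ∫ t in Ioc 0 (2 * ℓ), ω t / t := by
        gcongr ?_ * ?_
        exact setIntegral_mono_set hInt hnn
          (Ioc_subset_Ioc (by positivity) le_rfl).eventuallyLE
    _ ≤ 2 * (D * ω (2 * ℓ)) := by
        gcongr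
        exact (hD (2 * ℓ) (by linarith)).2
    _ ≤ 2 * (|D| * (C * ω ℓ)) := by
        gcongr
        · exact le_abs_self D
        · exact hdb ℓ hℓ
    _ = 2 * |D| * C * ω ℓ := by ring

variable {n : ℕ} {Y : Type*} [NormedAddCommGroup Y] [NormedSpace ℝ Y]

/-- The points at which the averages of `f` over all families of homothetically shrinking cubes
converge to the value of `f`. -/
def averagePoints (f : EuclideanSpace ℝ (Fin n) → Y) : Set (EuclideanSpace ℝ (Fin n)) :=
  {x | ∀ (c : EuclideanSpace ℝ (Fin n)) (ℓ : ℝ), 0 < ℓ → x ∈ cube c ℓ →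
    Tendsto (fun k : ℕ => ⨍ y in cube (shrink x c k) (ℓ / 2 ^ k), f y) atTop (nhds (f x))}

variable [CompleteSpace Y] {f : EuclideanSpace ℝ (Fin n) → Y}

lemma norm_setAverage_shrink_sub_le (hω : Admissible ω) (hf : LocallyIntegrable f)
    {x c : EuclideanSpace ℝ (Fin n)} {ℓ : ℝ} (hℓ : 0 < ℓ) (hx : x ∈ cube c ℓ) {E : ℝ} (N : ℕ)
    (hE : ∀ k < N, osc ω f (shrink x c k) (ℓ / 2 ^ k) ≤ E) :
    ‖(⨍ y in cube (shrink x c N) (ℓ / 2 ^ N), f y) - ⨍ y in cube c ℓ, f y‖ ≤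
      2 ^ n * E * ∑ k ∈ Finset.range N, ω (ℓ / 2 ^ k) := by
  induction N with
  | zero => simp
  | succ N ih =>
    have hp : 0 < ℓ / 2 ^ N := by positivity
    have he : ℓ / 2 ^ (N + 1) = ℓ / 2 ^ N / 2 := by
      rw [pow_succ]
      field_simp
    have hwp : 0 < ω (ℓ / 2 ^ N) := hω.1 _ hp
    have h1 := ih fun k hk => hE k (hk.trans N.lt_succ_self)
    have hsub := cube_shrink_subset (mem_cube_shrink hx N) 1
    rw [← shrink_succ, pow_one] at hsub
    have h2 := norm_setAverage_half_sub_le hf hp hsub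
      (⨍ y in cube (shrink x c N) (ℓ / 2 ^ N), f y)
    have h3 := hE N N.lt_succ_self
    rw [osc, one_div, inv_mul_le_iff₀ hwp] at h3
    rw [he, Finset.sum_range_succ, mul_add]
    refine (norm_sub_le_norm_sub_add_norm_sub _
      (⨍ y in cube (shrink x c N) (ℓ / 2 ^ N), f y) _).trans ?_
    rw [add_comm]
    refine add_le_add h1 (h2.trans ?_)
    calc (2 : ℝ) ^ n * _ ≤ 2 ^ n * (ω (ℓ / 2 ^ N) * E) := by gcongr
      _ = 2 ^ n * E * ω (ℓ / 2 ^ N) := by ring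

variable {K : ℝ}

lemma norm_sub_setAverage_le (hω : Admissible ω)
    (hK : ∀ ℓ : ℝ, 0 < ℓ → ∀ N : ℕ, ∑ k ∈ Finset.range N, ω (ℓ / 2 ^ k) ≤ K * ω ℓ)
    (hf : LocallyIntegrable f)
    {x c : EuclideanSpace ℝ (Fin n)} (hxf : x ∈ averagePoints f) {ℓ : ℝ} (hℓ : 0 < ℓ)
    (hx : x ∈ cube c ℓ) {E : ℝ} (hE0 : 0 ≤ E)
    (hE : ∀ k : ℕ, osc ω f (shrink x c k) (ℓ / 2 ^ k) ≤ E) :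
    ‖f x - ⨍ y in cube c ℓ, f y‖ ≤ 2 ^ n * E * (K * ω ℓ) := by
  refine le_of_tendsto ((hxf c ℓ hℓ hx).sub_const _).norm (Eventually.of_forall fun N => ?_)
  refine (norm_setAverage_shrink_sub_le hω hf hℓ hx N fun k _ => hE k).trans ?_
  gcongr
  exact hK ℓ hℓ N

/-- A bound which sees the global `BMO` constant `M` only through cubes of side at most `d`. -/
lemma norm_sub_setAverage_le_of_large (hω : Admissible ω) (hK0 : 0 ≤ K)
    (hK : ∀ ℓ : ℝ, 0 < ℓ → ∀ N : ℕ, ∑ k ∈ Finset.range N, ω (ℓ / 2 ^ k) ≤ K * ω ℓ)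
    (hf : LocallyIntegrable f) {M : ℝ} (hM0 : 0 ≤ M) (hM : BMOLE ω f M)
    {x c : EuclideanSpace ℝ (Fin n)} (hxf : x ∈ averagePoints f) {ℓ : ℝ} (hℓ : 0 < ℓ)
    (hx : x ∈ cube c ℓ) {E d : ℝ} (hE0 : 0 ≤ E) (hd : 0 < d)
    (hE : ∀ (c : EuclideanSpace ℝ (Fin n)) (ℓ : ℝ), 0 < ℓ → d < ℓ → osc ω f c ℓ ≤ E) :
    ‖f x - ⨍ y in cube c ℓ, f y‖ ≤ 2 ^ n * E * (K * ω ℓ) + 2 ^ n * M * (K * ω d) := by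
  have hex : ∃ N : ℕ, ℓ / 2 ^ N ≤ d := by
    obtain ⟨N, hN⟩ := pow_unbounded_of_one_lt (ℓ / d) (one_lt_two (α := ℝ))
    refine ⟨N, ?_⟩
    rw [div_lt_iff₀ hd] at hN
    rw [div_le_iff₀ (by positivity)]
    linarith
  classical
  set N := Nat.find hex
  have hN : ℓ / 2 ^ N ≤ d := Nat.find_spec hex
  have hp : 0 < ℓ / 2 ^ N := by positivity
  have h1 := norm_setAverage_shrink_sub_le hω hf hℓ hx (E := E) N fun k hk =>
    hE _ _ (by positivity) (not_le.1 (Nat.find_min hex hk))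
  have h2 := norm_sub_setAverage_le hω hK hf hxf hp (mem_cube_shrink hx N) hM0
    fun k => hM _ _ (by positivity)
  refine (norm_sub_le_norm_sub_add_norm_sub _
      (⨍ y in cube (shrink x c N) (ℓ / 2 ^ N), f y) _).trans ?_
  rw [add_comm]
  refine add_le_add (h1.trans ?_) (h2.trans ?_)
  · gcongr
    exact hK ℓ hℓ N
  · gcongr
    exact hω.2.1 _ _ hp hN

lemma norm_sub_le_of_osc_le (hω : Admissible ω)
    (hK : ∀ ℓ : ℝ, 0 < ℓ → ∀ N : ℕ, ∑ k ∈ Finset.range N, ω (ℓ / 2 ^ k) ≤ K * ω ℓ)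
    (hf : LocallyIntegrable f) {x y : EuclideanSpace ℝ (Fin n)} (hxf : x ∈ averagePoints f)
    (hyf : y ∈ averagePoints f) (hxy : x ≠ y) {E : ℝ} (hE0 : 0 ≤ E)
    (hE : ∀ (c : EuclideanSpace ℝ (Fin n)) (ℓ : ℝ), 0 < ℓ → ℓ ≤ ‖x - y‖ →
      (∀ z ∈ cube c ℓ, ‖x - z‖ ≤ n * ‖x - y‖) → osc ω f c ℓ ≤ E) :
    ‖f x - f y‖ ≤ 2 * (2 ^ n * K) * E * ω ‖x - y‖ := by
  have ht : 0 < ‖x - y‖ := norm_pos_iff.2 (sub_ne_zero.2 hxy)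
  obtain ⟨c, hx, hy⟩ := exists_cube_mem_mem x y
  have key : ∀ z ∈ averagePoints f, z ∈ cube c ‖x - y‖ →
      ‖f z - ⨍ y in cube c ‖x - y‖, f y‖ ≤ 2 ^ n * E * (K * ω ‖x - y‖) := by
    intro z hzf hz
    refine norm_sub_setAverage_le hω hK hf hzf ht hz hE0 fun k => ?_
    refine hE _ _ (by positivity) (div_le_self ht.le (one_le_pow₀ (by norm_num))) fun w hw => ?_
    exact norm_sub_le_of_mem_cube hx (cube_shrink_subset hz k hw) ht.le
  have h1 := key x hxf hx
  have h2 := key y hyf hy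
  rw [norm_sub_rev] at h2
  refine (norm_sub_le_norm_sub_add_norm_sub _ (⨍ y in cube c ‖x - y‖, f y) _).trans ?_
  linarith

lemma VMOlarge.exists_norm_sub_le_of_far (hlarge : VMOlarge ω f) (hfar : VMOfar ω f)
    (hω : Admissible ω) (hK0 : 0 ≤ K)
    (hK : ∀ ℓ : ℝ, 0 < ℓ → ∀ N : ℕ, ∑ k ∈ Finset.range N, ω (ℓ / 2 ^ k) ≤ K * ω ℓ)
    (hf : LocallyIntegrable f) {ε : ℝ} (hε : 0 < ε) :
    ∃ R : ℝ, ∀ x ∈ averagePoints f, ∀ y ∈ averagePoints f, x ≠ y → R < ‖x‖ →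
      ‖f x - f y‖ ≤ ε * ω ‖x - y‖ := by
  obtain ⟨⟨M₀, hM₀⟩, hlarge⟩ := hlarge
  set M := max M₀ 0
  have hM0 : 0 ≤ M := le_max_right _ _
  have hM : BMOLE ω f M := fun c ℓ hℓ => (hM₀ c ℓ hℓ).trans (le_max_left _ _)
  set A : ℝ := 2 ^ n * K
  have hA : 0 ≤ A := by positivity
  set ε₁ := ε / (4 * (A + 1))
  have hε₁ : 0 < ε₁ := by positivity
  have hAε : 2 * A * ε₁ ≤ ε / 2 := by
    have : 4 * (A + 1) * ε₁ = ε := mul_div_cancel₀ _ (by positivity)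
    nlinarith
  obtain ⟨d, hd, hd'⟩ := hlarge ε₁ hε₁
  obtain ⟨ρ, hρ, hρ'⟩ := hfar.2 ε₁ hε₁
  obtain ⟨T, hT, hT0⟩ : ∃ T : ℝ, 2 * (2 ^ n * M * (K * ω d)) / (ε / 2) ≤ ω T ∧ 0 < T :=
    ((hω.2.2.2.1.eventually_ge_atTop _).and (eventually_gt_atTop 0)).exists
  refine ⟨ρ + n * T, fun x hx y hy hxy hR => ?_⟩
  have ht : 0 < ‖x - y‖ := norm_pos_iff.2 (sub_ne_zero.2 hxy)
  have hωt := hω.1 _ ht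
  rcases lt_or_ge ‖x - y‖ T with h | h
  · refine (norm_sub_le_of_osc_le hω hK hf hx hy hxy hε₁.le fun c ℓ hℓ _ hz =>
      hρ' c ℓ hℓ ?_).trans ?_
    · have : ρ < ‖x‖ - n * T := by linarith
      refine this.trans_le ((Metric.le_infDist ⟨c, self_mem_cube c hℓ.le⟩).2 fun z hzc => ?_)
      have h1 := hz z hzc
      have h2 : (n : ℝ) * ‖x - y‖ ≤ n * T := by gcongr
      have h3 := norm_le_norm_add_norm_sub' x z
      rw [dist_zero_left]
      linarith
    · gcongr
      linarith
  · obtain ⟨c, hxc, hyc⟩ := exists_cube_mem_mem x y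
    have h1 := norm_sub_setAverage_le_of_large hω hK0 hK hf hM0 hM hx ht hxc hε₁.le hd hd'
    have h2 := norm_sub_setAverage_le_of_large hω hK0 hK hf hM0 hM hy ht hyc hε₁.le hd hd'
    rw [norm_sub_rev] at h2
    have h3 := hω.2.1 T _ hT0 h
    rw [div_le_iff₀ (by positivity)] at hT
    refine (norm_sub_le_norm_sub_add_norm_sub _ (⨍ y in cube c ‖x - y‖, f y) _).trans ?_
    have h4 : 2 * (2 ^ n * ε₁ * (K * ω ‖x - y‖)) ≤ ε / 2 * ω ‖x - y‖ := by
      calc 2 * (2 ^ n * ε₁ * (K * ω ‖x - y‖)) = 2 * A * ε₁ * ω ‖x - y‖ := by ring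
        _ ≤ _ := by gcongr
    have h5 : ω T * (ε / 2) ≤ ω ‖x - y‖ * (ε / 2) := by gcongr
    linarith

end Campanato

section Mollify

open MeasureTheory

variable {E Y : Type*} [NormedAddCommGroup E] [InnerProductSpace ℝ E] [FiniteDimensional ℝ E]
  [MeasurableSpace E] [BorelSpace E] {μ : Measure E} [μ.IsAddHaarMeasure]
  [NormedAddCommGroup Y] [NormedSpace ℝ Y] [CompleteSpace Y]

/-- Mollification at scale `r`. -/
lemma MeasureTheory.LocallyIntegrable.exists_mollification {f : E → Y}
    (hf : LocallyIntegrable f μ) {r : ℝ} (hr : 0 < r) :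
    ∃ g : E → Y, ContDiff ℝ (⊤ : ℕ∞) g ∧
      (∀ (x y : E) (B : ℝ), (∀ᵐ z ∂μ, ‖z‖ ≤ r → ‖f (x - z) - f (y - z)‖ ≤ B) →
        ‖g x - g y‖ ≤ B) ∧
      ∀ (x : E) (v : Y) (B : ℝ), (∀ᵐ z ∂μ, ‖z‖ ≤ r → ‖f (x - z) - v‖ ≤ B) → ‖g x - v‖ ≤ B := by
  let b : ContDiffBump (0 : E) := ⟨r / 2, r, by linarith, by linarith⟩
  set ρ : E → ℝ := b.normed μ with hρ
  have hρc : Continuous ρ := b.continuous_normed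
  have hρs : HasCompactSupport ρ := b.hasCompactSupport_normed
  have hρi : Integrable ρ μ := hρc.integrable_of_hasCompactSupport hρs
  have hρ1 : ∫ z, ρ z ∂μ = 1 := b.integral_normed
  have hρ0 : ∀ z, 0 ≤ ρ z := b.nonneg_normed
  have hρr : ∀ z, r < ‖z‖ → ρ z = 0 := by
    intro z hz
    by_contra hne
    have : z ∈ Function.support ρ := hne
    rw [hρ, b.support_normed_eq, mem_ball_zero_iff] at this
    exact absurd this (not_lt.2 hz.le)
  have hbound : ∀ (F : E → Y) (B : ℝ), (∀ᵐ z ∂μ, ‖z‖ ≤ r → ‖F z‖ ≤ B) →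
      ‖∫ z, ρ z • F z ∂μ‖ ≤ B := by
    intro F B hB
    have h1 : ‖∫ z, ρ z • F z ∂μ‖ ≤ ∫ z, ρ z * B ∂μ := by
      refine norm_integral_le_of_norm_le (hρi.mul_const B) ?_
      filter_upwards [hB] with z hz
      rw [norm_smul, Real.norm_eq_abs, abs_of_nonneg (hρ0 z)]
      rcases le_or_gt ‖z‖ r with h | h
      · exact mul_le_mul_of_nonneg_left (hz h) (hρ0 z)
      · simp [hρr z h]
    rwa [integral_mul_const, hρ1, one_mul] at h1
  have hconv : ∀ x, Integrable (fun z => ρ z • f (x - z)) μ := fun x =>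
    hρs.convolutionExists_left (ContinuousLinearMap.lsmul ℝ ℝ) hρc hf x
  have hcd := hρs.contDiff_convolution_left (ContinuousLinearMap.lsmul ℝ ℝ)
    (b.contDiff_normed (n := ⊤)) hf
  refine ⟨_, hcd, fun x y B hB => ?_, fun x v B hB => ?_⟩
  · rw [convolution_def, convolution_def]
    simp only [ContinuousLinearMap.lsmul_apply]
    rw [← integral_sub (hconv x) (hconv y)]
    simp only [← smul_sub]
    exact hbound _ B hB
  · have hv : v = ∫ z, ρ z • v ∂μ := by rw [integral_smul_const, hρ1, one_smul]
    rw [convolution_def, hv]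
    simp only [ContinuousLinearMap.lsmul_apply]
    rw [← integral_sub (hconv x) (hρi.smul_const v)]
    simp only [← smul_sub]
    exact hbound _ B hB

end Mollify

section Cutoff

variable {E : Type*} [NormedAddCommGroup E] [InnerProductSpace ℝ E]

lemma log_one_add_sq_sub_le {a b : ℝ} (hb : 0 < b) (hab : b ≤ a) :
    |Real.log (1 + a ^ 2) - Real.log (1 + b ^ 2)| ≤ 2 * ((a - b) / b) := by
  have ha : 0 < a := hb.trans_le hab
  have hsq : b ^ 2 ≤ a ^ 2 := by gcongr
  rw [abs_of_nonneg (sub_nonneg.2 (Real.log_le_log (by positivity) (by linarith))),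
    ← Real.log_div (by positivity) (by positivity)]
  have h1 : (1 + a ^ 2) / (1 + b ^ 2) ≤ (a / b) ^ 2 := by
    rw [div_pow, div_le_div_iff₀ (by positivity) (by positivity)]
    linarith
  calc Real.log ((1 + a ^ 2) / (1 + b ^ 2)) ≤ Real.log ((a / b) ^ 2) :=
        Real.log_le_log (by positivity) h1
    _ = 2 * Real.log (a / b) := by rw [Real.log_pow]; norm_num
    _ ≤ 2 * (a / b - 1) := by
        gcongr
        exact Real.log_le_sub_one_of_pos (by positivity)
    _ = 2 * ((a - b) / b) := by field_simp

/-- Logarithmic cutoff functions: arbitrarily slowly varying with respect to `log ‖x‖`. -/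
lemma exists_log_cutoff (E : Type*) [NormedAddCommGroup E] [InnerProductSpace ℝ E]
    [FiniteDimensional ℝ E] {κ : ℝ} (hκ : 0 < κ) (R : ℝ) :
    ∃ φ : E → ℝ, ContDiff ℝ (⊤ : ℕ∞) φ ∧ HasCompactSupport φ ∧ (∀ x, 0 ≤ φ x) ∧ (∀ x, φ x ≤ 1) ∧
      (∀ x, ‖x‖ ≤ R → φ x = 1) ∧
      ∀ x y, y ≠ 0 → ‖y‖ ≤ ‖x‖ → |φ x - φ y| ≤ κ * ((‖x‖ - ‖y‖) / ‖y‖) := by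
  let b : ContDiffBump (0 : ℝ) := ⟨1, 2, one_pos, one_lt_two⟩
  obtain ⟨L, hL⟩ := ContDiff.lipschitzWith_of_hasCompactSupport b.hasCompactSupport
    (b.contDiff (n := 1)) one_ne_zero
  have hL0 : (0 : ℝ) ≤ L := L.2
  have hlog0 : ∀ s : ℝ, 0 ≤ Real.log (1 + s ^ 2) := fun s =>
    Real.log_nonneg (by nlinarith [sq_nonneg s])
  obtain ⟨η, hη, hηκ, hηR⟩ : ∃ η : ℝ, 0 < η ∧ L * η * 2 ≤ κ ∧ η * Real.log (1 + R ^ 2) ≤ 1 := by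
    have hR := hlog0 R
    refine ⟨min (κ / (2 * (L + 1))) (1 / (Real.log (1 + R ^ 2) + 1)), by positivity, ?_, ?_⟩
    · calc (L : ℝ) * min (κ / (2 * (L + 1))) (1 / (Real.log (1 + R ^ 2) + 1)) * 2
          ≤ (L + 1) * (κ / (2 * (L + 1))) * 2 := by
            gcongr
            · linarith
            · exact min_le_left _ _
        _ = κ := by field_simp
    · calc min (κ / (2 * (L + 1))) (1 / (Real.log (1 + R ^ 2) + 1)) * Real.log (1 + R ^ 2)
          ≤ 1 / (Real.log (1 + R ^ 2) + 1) * (Real.log (1 + R ^ 2) + 1) := by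
            gcongr
            · exact min_le_right _ _
            · linarith
        _ = 1 := by field_simp
  refine ⟨fun x => b (η * Real.log (1 + ‖x‖ ^ 2)), ?_, ?_, fun x => b.nonneg, fun x => b.le_one,
    fun x hx => ?_, fun x y hy hxy => ?_⟩
  · refine b.contDiff.comp (contDiff_const.mul (ContDiff.log ?_ fun x => by positivity))
    exact contDiff_const.add (contDiff_norm_sq ℝ)
  · refine HasCompactSupport.intro
      (isCompact_closedBall (0 : E) (Real.sqrt (Real.exp (2 / η)))) fun x hx => ?_
    rw [mem_closedBall_zero_iff, not_le] at hx
    refine b.zero_of_le_dist ?_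
    have h1 : Real.exp (2 / η) ≤ 1 + ‖x‖ ^ 2 := by
      have := (Real.sqrt_lt' ((Real.sqrt_nonneg _).trans_lt hx)).1 hx
      linarith
    have h2 := (Real.le_log_iff_exp_le (by positivity)).2 h1
    rw [div_le_iff₀ hη] at h2
    rw [Real.dist_eq, sub_zero]
    exact le_trans (by linarith) (le_abs_self _)
  · refine b.one_of_mem_closedBall ?_
    rw [mem_closedBall_zero_iff, Real.norm_eq_abs,
      abs_of_nonneg (mul_nonneg hη.le (hlog0 ‖x‖))]
    refine le_trans ?_ hηR
    gcongr
  · have h1 := hL.dist_le_mul (η * Real.log (1 + ‖x‖ ^ 2)) (η * Real.log (1 + ‖y‖ ^ 2))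
    rw [Real.dist_eq, Real.dist_eq, ← mul_sub, abs_mul, abs_of_pos hη] at h1
    have hy0 := norm_pos_iff.2 hy
    have h2 := log_one_add_sq_sub_le hy0 hxy
    have h3 : 0 ≤ (‖x‖ - ‖y‖) / ‖y‖ := div_nonneg (sub_nonneg.2 hxy) hy0.le
    calc _ ≤ _ := h1
      _ ≤ L * (η * (2 * ((‖x‖ - ‖y‖) / ‖y‖))) := by gcongr
      _ = L * η * 2 * ((‖x‖ - ‖y‖) / ‖y‖) := by ring
      _ ≤ _ := by gcongr

end Cutoff

section Truncate

variable {E Y : Type*} [NormedAddCommGroup E] [NormedAddCommGroup Y] {ω : ℝ → ℝ}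

/-- Chaining along a segment: a function with modulus `ω` grows at most linearly, with slope
comparable to `ω t / t`. -/
lemma HolderLE.norm_sub_zero_le [NormedSpace ℝ E] (hω : Admissible ω) {g : E → Y} {M : ℝ}
    (hM0 : 0 ≤ M) (hg : HolderLE ω g M) {y : E} {t : ℝ} (ht : 0 < t) (hty : t ≤ ‖y‖) :
    ‖g y - g 0‖ ≤ 2 * M * (‖y‖ / t) * ω t := by
  set k := ⌈‖y‖ / t⌉₊
  have hyt : 1 ≤ ‖y‖ / t := (one_le_div ht).2 hty
  have hk : ‖y‖ / t ≤ k := Nat.le_ceil _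
  have hk' : (k : ℝ) < ‖y‖ / t + 1 := Nat.ceil_lt_add_one (by linarith)
  have hk0 : (0 : ℝ) < k := by linarith
  have hy0 : y ≠ 0 := norm_pos_iff.1 (ht.trans_le hty)
  have hωt := hω.1 t ht
  have hstep : ∀ j : ℕ, ‖g (((j + 1 : ℕ) / k : ℝ) • y) - g ((j / k : ℝ) • y)‖ ≤ M * ω t := by
    intro j
    have hd : ((j + 1 : ℕ) / k : ℝ) • y - (j / k : ℝ) • y = (1 / k : ℝ) • y := by
      rw [← sub_smul]
      congr 1
      push_cast
      ring
    have hne : (1 / k : ℝ) • y ≠ 0 := smul_ne_zero (by positivity) hy0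
    refine (hg _ _ (sub_ne_zero.1 (hd ▸ hne))).trans ?_
    rw [hd]
    gcongr
    refine hω.2.1 _ _ (norm_pos_iff.2 hne) ?_
    rw [norm_smul, Real.norm_eq_abs, abs_of_pos (by positivity), one_div, inv_mul_le_iff₀ hk0]
    rwa [div_le_iff₀ ht] at hk
  have hsum := Finset.sum_range_sub (fun j : ℕ => g ((j / k : ℝ) • y)) k
  simp only [div_self hk0.ne', one_smul, Nat.cast_zero, zero_div, zero_smul] at hsum
  rw [← hsum]
  calc _ ≤ ∑ j ∈ Finset.range k, M * ω t := norm_sum_le_of_le _ fun j _ => hstep j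
    _ = k * (M * ω t) := by simp
    _ ≤ 2 * (‖y‖ / t) * (M * ω t) := by
        gcongr
        linarith
    _ = _ := by ring

/-- A function with modulus `ω` which oscillates little away from the origin can be truncated
smoothly with a small error. -/
lemma HolderLE.exists_cutoff [NormedSpace ℝ Y] [InnerProductSpace ℝ E] [FiniteDimensional ℝ E]
    (hω : Admissible ω) {g : E → Y} {M : ℝ} (hM0 : 0 ≤ M) (hg : HolderLE ω g M) (hg0 : g 0 = 0) {ε : ℝ} (hε : 0 < ε)
    {R₀ : ℝ} (hR₀ : 0 < R₀)
    (hfar : ∀ x y, x ≠ y → R₀ < ‖x‖ → ‖g x - g y‖ ≤ ε * ω ‖x - y‖) :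
    ∃ φ : E → ℝ, ContDiff ℝ (⊤ : ℕ∞) φ ∧ HasCompactSupport φ ∧
      HolderLE ω (fun x => (1 - φ x) • g x) (2 * ε) := by
  obtain ⟨T, hT, hT0⟩ : ∃ T : ℝ, M * ω R₀ / ε ≤ ω T ∧ 0 < T :=
    ((hω.2.2.2.1.eventually_ge_atTop _).and (Filter.eventually_gt_atTop 0)).exists
  rw [div_le_iff₀ hε] at hT
  obtain ⟨φ, hφ, hφs, hφ0, hφ1, hφR, hφL⟩ :=
    exists_log_cutoff E (κ := ε / (2 * (M + 1))) (by positivity) (R₀ + T)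
  refine ⟨φ, hφ, hφs, ?_⟩
  have main : ∀ x y, x ≠ y → ‖y‖ ≤ ‖x‖ →
      ‖(1 - φ x) • g x - (1 - φ y) • g y‖ ≤ 2 * ε * ω ‖x - y‖ := by
    intro x y hxy hyx
    have ht : 0 < ‖x - y‖ := norm_pos_iff.2 (sub_ne_zero.2 hxy)
    have hωt := hω.1 _ ht
    rcases le_or_gt ‖x‖ (R₀ + T) with hx | hx
    · rw [hφR x hx, hφR y (hyx.trans hx)]
      simp only [sub_self, zero_smul, norm_zero]
      positivity
    have h1 : ‖(1 - φ x) • (g x - g y)‖ ≤ ε * ω ‖x - y‖ := by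
      rw [norm_smul, Real.norm_eq_abs, abs_of_nonneg (sub_nonneg.2 (hφ1 x))]
      refine (mul_le_of_le_one_left (norm_nonneg _) (by linarith [hφ0 x])).trans ?_
      exact hfar x y hxy (by linarith)
    have h2 : |φ x - φ y| * ‖g y‖ ≤ ε * ω ‖x - y‖ := by
      by_cases hy0 : y = 0
      · rw [hy0, hg0, norm_zero, mul_zero, sub_zero]
        have := hω.1 ‖x‖ (by linarith)
        positivity
      have hypos := norm_pos_iff.2 hy0
      have habs : |φ x - φ y| ≤ 1 := abs_le.2
        ⟨by linarith [hφ0 x, hφ1 y], by linarith [hφ1 x, hφ0 y]⟩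
      rcases le_or_gt ‖x - y‖ ‖y‖ with hty | hty
      · have h3 := hg.norm_sub_zero_le hω hM0 ht hty
        rw [hg0, sub_zero] at h3
        have h4 : |φ x - φ y| ≤ ε / (2 * (M + 1)) * (‖x - y‖ / ‖y‖) := by
          refine (hφL x y hy0 hyx).trans ?_
          gcongr
          exact norm_sub_norm_le x y
        calc |φ x - φ y| * ‖g y‖
            ≤ ε / (2 * (M + 1)) * (‖x - y‖ / ‖y‖) * (2 * M * (‖y‖ / ‖x - y‖) * ω ‖x - y‖) := by
              gcongr
          _ = M / (M + 1) * (ε * ω ‖x - y‖) := by field_simp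
          _ ≤ 1 * (ε * ω ‖x - y‖) := by
              gcongr
              exact div_le_one_of_le₀ (by linarith) (by linarith)
          _ = _ := one_mul _
      · refine (mul_le_of_le_one_left (norm_nonneg _) habs).trans ?_
        rcases lt_or_ge R₀ ‖y‖ with hR | hR
        · have h3 := hfar y 0 hy0 hR
          rw [hg0, sub_zero, sub_zero] at h3
          refine h3.trans ?_
          gcongr
          exact hω.2.1 _ _ hypos hty.le
        · have h3 := hg y 0 hy0
          rw [hg0, sub_zero, sub_zero] at h3
          have h4 : M * ω ‖y‖ ≤ M * ω R₀ := by
            gcongr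
            exact hω.2.1 _ _ hypos hR
          have h5 : ω T ≤ ω ‖x - y‖ := hω.2.1 _ _ hT0 (by linarith [norm_sub_norm_le x y])
          have h6 : ω T * ε ≤ ω ‖x - y‖ * ε := by gcongr
          linarith
    have hsplit : (1 - φ x) • g x - (1 - φ y) • g y =
        (1 - φ x) • (g x - g y) - (φ x - φ y) • g y := by
      module
    rw [hsplit]
    refine (norm_sub_le _ _).trans ?_
    rw [norm_smul (φ x - φ y), Real.norm_eq_abs]
    linarith
  intro x y hxy
  rcases le_total ‖y‖ ‖x‖ with h | h
  · exact main x y hxy h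
  · rw [norm_sub_rev, norm_sub_rev x y]
    exact main y x hxy.symm h

end Truncate

section Oscillation

open MeasureTheory

variable {ω : ℝ → ℝ} {n : ℕ} {Y : Type*} [NormedAddCommGroup Y] [NormedSpace ℝ Y]

lemma Admissible.exists_two_pow_mul_le (hω : Admissible ω) (n : ℕ) :
    ∃ C : ℝ, 0 < C ∧ ∀ t : ℝ, 0 < t → ω (2 ^ n * t) ≤ C * ω t := by
  obtain ⟨C, hC, hdb⟩ := hω.2.2.2.2.2
  have hC0 : 0 < C := by linarith
  refine ⟨C ^ n, by positivity, fun t ht => ?_⟩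
  induction n with
  | zero => simp
  | succ n ih =>
    calc ω (2 ^ (n + 1) * t) = ω (2 * (2 ^ n * t)) := by ring_nf
      _ ≤ C * ω (2 ^ n * t) := hdb _ (by positivity)
      _ ≤ C * (C ^ n * ω t) := by gcongr
      _ = C ^ (n + 1) * ω t := by ring

lemma osc_nonneg (hω : Admissible ω) (f : EuclideanSpace ℝ (Fin n) → Y)
    (c : EuclideanSpace ℝ (Fin n)) {ℓ : ℝ} (hℓ : 0 < ℓ) : 0 ≤ osc ω f c ℓ := by
  have := hω.1 ℓ hℓ
  rw [osc, setAverage_eq]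
  exact mul_nonneg (by positivity) (smul_nonneg (by positivity)
    (integral_nonneg fun _ => norm_nonneg _))

lemma osc_le_osc_sub_add_osc (hω : Admissible ω) {f g : EuclideanSpace ℝ (Fin n) → Y}
    (hf : LocallyIntegrable f) (hg : LocallyIntegrable g)
    (c : EuclideanSpace ℝ (Fin n)) {ℓ : ℝ} (hℓ : 0 < ℓ) :
    osc ω f c ℓ ≤ osc ω (fun x => f x - g x) c ℓ + osc ω g c ℓ := by
  have hωℓ := hω.1 ℓ hℓ
  have hfi := hf.integrableOn_cube c hℓ.le
  have hgi := hg.integrableOn_cube c hℓ.le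
  have hconst : ∀ v : Y, IntegrableOn (fun _ => v) (cube c ℓ) := fun v =>
    integrableOn_const (volume_cube_ne_top c hℓ.le)
  have havg : ⨍ z in cube c ℓ, (f z - g z) = (⨍ z in cube c ℓ, f z) - ⨍ z in cube c ℓ, g z := by
    rw [setAverage_eq, setAverage_eq, setAverage_eq, integral_sub hfi hgi, smul_sub]
  rw [osc, osc, osc, ← mul_add, havg]
  gcongr
  generalize (⨍ z in cube c ℓ, f z) = u
  generalize (⨍ z in cube c ℓ, g z) = v
  rw [setAverage_eq, setAverage_eq, setAverage_eq, ← smul_add]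
  have h1 := ((hfi.sub hgi).sub (hconst (u - v))).norm
  have h2 := (hgi.sub (hconst v)).norm
  simp only [Pi.sub_apply] at h1 h2
  rw [← integral_add h1 h2]
  refine smul_le_smul_of_nonneg_left ?_ (by positivity)
  refine integral_mono ((hfi.sub (hconst _)).norm) (h1.add h2) fun y => ?_
  dsimp only
  refine le_trans (le_of_eq ?_) (norm_add_le _ _)
  congr 1
  abel

variable [CompleteSpace Y]

lemma osc_le_of_norm_sub_le (hω : Admissible ω) {h : EuclideanSpace ℝ (Fin n) → Y}
    (hh : LocallyIntegrable h) {G : Set (EuclideanSpace ℝ (Fin n))} (hG : ∀ᵐ x, x ∈ G)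
    {c : EuclideanSpace ℝ (Fin n)} {ℓ : ℝ} (hℓ : 0 < ℓ) {B : ℝ}
    (hB : ∀ x ∈ G, ∀ y ∈ G, x ∈ cube c ℓ → y ∈ cube c ℓ → ‖h x - h y‖ ≤ B * ω ℓ) :
    osc ω h c ℓ ≤ B := by
  rw [osc, one_div, inv_mul_le_iff₀ (hω.1 ℓ hℓ), mul_comm]
  exact setAverage_norm_sub_setAverage_le hG hℓ (hh.integrableOn_cube c hℓ.le) hB

lemma exists_lipschitz_osc_le (hω : Admissible ω) {g : EuclideanSpace ℝ (Fin n) → Y}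
    (hg : ContDiff ℝ (⊤ : ℕ∞) g) (hgs : HasCompactSupport g) :
    ∃ L : ℝ, ∀ (c : EuclideanSpace ℝ (Fin n)) (ℓ : ℝ), 0 < ℓ → osc ω g c ℓ ≤ L * (ℓ / ω ℓ) := by
  obtain ⟨L, hL⟩ := hg.lipschitzWith_of_hasCompactSupport hgs (by simp)
  refine ⟨L * n, fun c ℓ hℓ => ?_⟩
  have hωℓ := hω.1 ℓ hℓ
  refine osc_le_of_norm_sub_le hω hg.continuous.locallyIntegrable (G := univ) (by simp) hℓ
    fun x _ y _ hx hy => ?_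
  calc ‖g x - g y‖ ≤ L * ‖x - y‖ := hL.norm_sub_le x y
    _ ≤ L * (n * ℓ) := by
        gcongr
        exact norm_sub_le_of_mem_cube hx hy hℓ.le
    _ = L * n * (ℓ / ω ℓ) * ω ℓ := by field_simp

/-- Smooth compactly supported functions have uniformly small oscillation over small, large and
far away cubes. -/
lemma vanishing_osc_of_contDiff_of_hasCompactSupport (hω : Admissible ω)
    {g : EuclideanSpace ℝ (Fin n) → Y} (hg : ContDiff ℝ (⊤ : ℕ∞) g) (hgs : HasCompactSupport g)
    {ε : ℝ} (hε : 0 < ε) :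
    (∃ δ : ℝ, 0 < δ ∧ ∀ (c : EuclideanSpace ℝ (Fin n)) (ℓ : ℝ), 0 < ℓ → ℓ < δ →
        osc ω g c ℓ ≤ ε) ∧
      (∃ δ : ℝ, 0 < δ ∧ ∀ (c : EuclideanSpace ℝ (Fin n)) (ℓ : ℝ), 0 < ℓ → δ < ℓ →
        osc ω g c ℓ ≤ ε) ∧
      ∃ δ : ℝ, 0 < δ ∧ ∀ (c : EuclideanSpace ℝ (Fin n)) (ℓ : ℝ), 0 < ℓ →
        δ < Metric.infDist (0 : EuclideanSpace ℝ (Fin n)) (cube c ℓ) → osc ω g c ℓ ≤ ε := by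
  have hgl : LocallyIntegrable g := hg.continuous.locallyIntegrable
  refine ⟨?_, ?_, ?_⟩
  · obtain ⟨L, hL⟩ := exists_lipschitz_osc_le hω hg hgs
    have h1 : Tendsto (fun t => L * (t / ω t)) (nhdsWithin 0 (Ioi 0)) (nhds (L * 0)) :=
      hω.2.2.2.2.1.const_mul L
    rw [mul_zero] at h1
    obtain ⟨δ, hδ, hδ'⟩ := (mem_nhdsGT_iff_exists_Ioo_subset).1 (h1.eventually_lt_const hε)
    exact ⟨δ, hδ, fun c ℓ hℓ hℓδ => (hL c ℓ hℓ).trans (le_of_lt (hδ' ⟨hℓ, hℓδ⟩))⟩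
  · obtain ⟨B, hB⟩ := hgs.exists_bound_of_continuous hg.continuous
    obtain ⟨δ, hδ, hδ0⟩ : ∃ T : ℝ, 2 * B / ε ≤ ω T ∧ 0 < T :=
      ((hω.2.2.2.1.eventually_ge_atTop _).and (eventually_gt_atTop 0)).exists
    rw [div_le_iff₀ hε] at hδ
    refine ⟨δ, hδ0, fun c ℓ hℓ hℓδ => osc_le_of_norm_sub_le hω hgl (G := univ) (by simp) hℓ
      fun x _ y _ _ _ => ?_⟩
    have h1 : ω δ * ε ≤ ω ℓ * ε := by
      gcongr
      exact hω.2.1 _ _ hδ0 hℓδ.le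
    linarith [norm_sub_le (g x) (g y), hB x, hB y]
  · obtain ⟨r, hr⟩ := hgs.isCompact.isBounded.subset_closedBall 0
    refine ⟨max r 1, by positivity, fun c ℓ hℓ hd =>
      osc_le_of_norm_sub_le hω hgl (G := univ) (by simp) hℓ fun x _ y _ hx hy => ?_⟩
    have hz : ∀ z ∈ cube c ℓ, g z = 0 := fun z hz => by
      by_contra hne
      have h1 := hr (subset_tsupport g hne)
      have h2 := Metric.infDist_le_dist_of_mem (x := 0) hz
      rw [dist_comm] at h2
      rw [Metric.mem_closedBall] at h1
      linarith [le_max_left r 1]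
    rw [hz x hx, hz y hy, sub_zero, norm_zero]
    have := hω.1 ℓ hℓ
    positivity

lemma VMOfull_of_approx (hω : Admissible ω) {f : EuclideanSpace ℝ (Fin n) → Y}
    (hf : LocallyIntegrable f) (hM : ∃ M : ℝ, BMOLE ω f M)
    (happ : ∀ ε : ℝ, 0 < ε → ∃ g : EuclideanSpace ℝ (Fin n) → Y,
      ContDiff ℝ (⊤ : ℕ∞) g ∧ HasCompactSupport g ∧
      ∀ (c : EuclideanSpace ℝ (Fin n)) (ℓ : ℝ), 0 < ℓ →
        osc ω (fun x => f x - g x) c ℓ ≤ ε) :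
    VMOfull ω f := by
  have key : ∀ ε : ℝ, 0 < ε → ∃ g : EuclideanSpace ℝ (Fin n) → Y,
      ContDiff ℝ (⊤ : ℕ∞) g ∧ HasCompactSupport g ∧
      ∀ (c : EuclideanSpace ℝ (Fin n)) (ℓ : ℝ), 0 < ℓ → osc ω g c ℓ ≤ ε / 2 →
        osc ω f c ℓ ≤ ε := by
    intro ε hε
    obtain ⟨g, hg, hgs, hfg⟩ := happ (ε / 2) (half_pos hε)
    refine ⟨g, hg, hgs, fun c ℓ hℓ h => ?_⟩
    linarith [hfg c ℓ hℓ, osc_le_osc_sub_add_osc hω hf hg.continuous.locallyIntegrable c hℓ]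
  refine ⟨⟨hM, fun ε hε => ?_⟩, ⟨hM, fun ε hε => ?_⟩, ⟨hM, fun ε hε => ?_⟩⟩
  all_goals
    obtain ⟨g, hg, hgs, hfg⟩ := key ε hε
    obtain ⟨h1, h2, h3⟩ :=
      vanishing_osc_of_contDiff_of_hasCompactSupport hω hg hgs (half_pos hε)
  · obtain ⟨δ, hδ, h⟩ := h1
    exact ⟨δ, hδ, fun c ℓ hℓ hd => hfg c ℓ hℓ (h c ℓ hℓ hd)⟩
  · obtain ⟨δ, hδ, h⟩ := h2
    exact ⟨δ, hδ, fun c ℓ hℓ hd => hfg c ℓ hℓ (h c ℓ hℓ hd)⟩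
  · obtain ⟨δ, hδ, h⟩ := h3
    exact ⟨δ, hδ, fun c ℓ hℓ hd => hfg c ℓ hℓ (h c ℓ hℓ hd)⟩

/-- If `f` agrees almost everywhere with a function having vanishing `ω`-modulus, at small scales
and away from the origin, then it can be approximated by smooth compactly supported functions in
the `ω`-Hölder seminorm. -/
lemma exists_contDiff_norm_sub_le (hω : Admissible ω) {f : EuclideanSpace ℝ (Fin n) → Y}
    (hf : LocallyIntegrable f) {G : Set (EuclideanSpace ℝ (Fin n))} (hG : ∀ᵐ x, x ∈ G)
    {M : ℝ} (hM0 : 0 ≤ M)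
    (hM : ∀ x ∈ G, ∀ y ∈ G, x ≠ y → ‖f x - f y‖ ≤ M * ω ‖x - y‖)
    {ε δ R : ℝ} (hε : 0 < ε) (hδ : 0 < δ)
    (hsmall : ∀ x ∈ G, ∀ y ∈ G, x ≠ y → ‖x - y‖ < δ → ‖f x - f y‖ ≤ ε * ω ‖x - y‖)
    (hfar : ∀ x ∈ G, ∀ y ∈ G, x ≠ y → R < ‖x‖ → ‖f x - f y‖ ≤ ε * ω ‖x - y‖) :
    ∃ g : EuclideanSpace ℝ (Fin n) → Y, ContDiff ℝ (⊤ : ℕ∞) g ∧ HasCompactSupport g ∧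
      ∀ x ∈ G, ∀ y ∈ G, x ≠ y → ‖(f x - g x) - (f y - g y)‖ ≤ 4 * ε * ω ‖x - y‖ := by
  have hGz : ∀ x, ∀ᵐ z : EuclideanSpace ℝ (Fin n), x - z ∈ G := fun x =>
    (quasiMeasurePreserving_sub_left_of_right_invariant volume x).ae hG
  have hωδ := hω.1 δ hδ
  obtain ⟨r, hr, hrM⟩ : ∃ r : ℝ, 0 < r ∧ M * ω r ≤ ε * ω δ := by
    have h1 : Tendsto (fun t => M * ω t) (nhdsWithin 0 (Ioi 0)) (nhds (M * 0)) :=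
      hω.2.2.1.const_mul M
    rw [mul_zero] at h1
    obtain ⟨r, hr, hr0⟩ := ((h1.eventually_lt_const (mul_pos hε hωδ)).and
      self_mem_nhdsWithin).exists
    exact ⟨r, hr0, hr.le⟩
  obtain ⟨g, hg, hgsub, hgv⟩ := hf.exists_mollification hr
  have hshift : ∀ {x y z : EuclideanSpace ℝ (Fin n)}, x - z - (y - z) = x - y :=
    fun {x y z} => sub_sub_sub_cancel_right x y z
  have hne : ∀ {x y : EuclideanSpace ℝ (Fin n)} (z), x ≠ y → x - z ≠ y - z :=
    fun z h h' => h (sub_left_injective h')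
  have hgM : HolderLE ω g M := fun x y hxy => by
    refine hgsub x y _ ?_
    filter_upwards [hGz x, hGz y] with z hx hy _
    simpa only [hshift] using hM _ hx _ hy (hne z hxy)
  have hgsmall : ∀ x y, x ≠ y → ‖x - y‖ < δ → ‖g x - g y‖ ≤ ε * ω ‖x - y‖ := by
    intro x y hxy hd
    refine hgsub x y _ ?_
    filter_upwards [hGz x, hGz y] with z hx hy _
    simpa only [hshift] using hsmall _ hx _ hy (hne z hxy) (by rwa [hshift])
  have hgfar : ∀ x y, x ≠ y → max R 0 + r < ‖x‖ → ‖g x - g y‖ ≤ ε * ω ‖x - y‖ := by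
    intro x y hxy hd
    refine hgsub x y _ ?_
    filter_upwards [hGz x, hGz y] with z hx hy hz
    simpa only [hshift] using hfar _ hx _ hy (hne z hxy)
      (by linarith [norm_sub_norm_le x z, le_max_left R 0])
  have hfg : ∀ x ∈ G, ‖f x - g x‖ ≤ ε * ω δ := by
    intro x hx
    rw [norm_sub_rev]
    refine (hgv x (f x) (M * ω r) ?_).trans hrM
    filter_upwards [hGz x] with z hxz hz
    by_cases hz0 : z = 0
    · rw [hz0, sub_zero, sub_self, norm_zero]
      have := hω.1 r hr
      positivity
    · refine (hM _ hxz x hx (by simpa using hz0)).trans ?_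
      rw [sub_sub_cancel_left, norm_neg]
      gcongr
      exact hω.2.1 _ _ (norm_pos_iff.2 hz0) hz
  obtain ⟨φ, hφ, hφs, hφg⟩ := HolderLE.exists_cutoff hω (g := fun x => g x - g 0) hM0
    (fun x y hxy => by simpa using hgM x y hxy) (sub_self _) hε (R₀ := max R 0 + r)
    (by positivity) (fun x y hxy hx => by simpa using hgfar x y hxy hx)
  refine ⟨fun x => φ x • (g x - g 0), hφ.smul (hg.sub contDiff_const), hφs.smul_right,
    fun x hx y hy hxy => ?_⟩
  have ht : 0 < ‖x - y‖ := norm_pos_iff.2 (sub_ne_zero.2 hxy)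
  have h1 : ‖(f x - g x) - (f y - g y)‖ ≤ 2 * ε * ω ‖x - y‖ := by
    rcases lt_or_ge ‖x - y‖ δ with hd | hd
    · have h2 := hsmall x hx y hy hxy hd
      have h3 := hgsmall x y hxy hd
      have h4 : (f x - g x) - (f y - g y) = (f x - f y) - (g x - g y) := by abel
      rw [h4]
      linarith [norm_sub_le (f x - f y) (g x - g y)]
    · have h2 : ε * ω δ ≤ ε * ω ‖x - y‖ := by
        gcongr
        exact hω.2.1 _ _ hδ hd
      linarith [norm_sub_le (f x - g x) (f y - g y), hfg x hx, hfg y hy]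
  have h2 := hφg x y hxy
  have h3 : (f x - φ x • (g x - g 0)) - (f y - φ y • (g y - g 0)) =
      ((f x - g x) - (f y - g y)) +
        ((1 - φ x) • (g x - g 0) - (1 - φ y) • (g y - g 0)) := by
    module
  rw [h3]
  refine (norm_add_le _ _).trans ?_
  linarith

end Oscillation

/-- Theorem 1.8: for an admissible modulus with `[ω]_* < ∞`, `VMO^ω(ℝⁿ,Y)` equals the closure
of the compactly supported `C^∞` maps in the `BMO^ω` norm. -/
theorem vmo_eq_closure_smooth_compactly_supported (n : ℕ)
    {Y : Type*} [NormedAddCommGroup Y] [NormedSpace ℝ Y] [CompleteSpace Y]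
    (ω : ℝ → ℝ) (hω : Admissible ω)
    (hdini : ∃ D : ℝ, ∀ s : ℝ, 0 < s →
      MeasureTheory.IntegrableOn (fun t => ω t / t) (Set.Ioc 0 s) ∧
      (∫ t in Set.Ioc (0:ℝ) s, ω t / t) ≤ D * ω s)
    (f : EuclideanSpace ℝ (Fin n) → Y)
    (hloc : MeasureTheory.LocallyIntegrable f) :
    VMOfull ω f ↔
      ((∃ M : ℝ, BMOLE ω f M) ∧ ∀ ε : ℝ, 0 < ε → ∃ g : EuclideanSpace ℝ (Fin n) → Y,
        ContDiff ℝ (⊤ : ℕ∞) g ∧ HasCompactSupport g ∧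
        ∀ (c : EuclideanSpace ℝ (Fin n)) (ℓ : ℝ), 0 < ℓ →
          osc ω (fun x => f x - g x) c ℓ ≤ ε) := by
  refine ⟨fun h => ?_, fun h => VMOfull_of_approx hω hloc h.1 h.2⟩
  obtain ⟨⟨hbmo, hsmall⟩, hlarge, hfar⟩ := h
  refine ⟨hbmo, fun ε hε => ?_⟩
  obtain ⟨K, hK0, hK⟩ := hω.exists_sum_dyadic_le hdini
  obtain ⟨C, hC, hCω⟩ := hω.exists_two_pow_mul_le n
  obtain ⟨M₀, hM₀⟩ := hbmo
  have hM : BMOLE ω f (max M₀ 0) := fun c ℓ hℓ => (hM₀ c ℓ hℓ).trans (le_max_left _ _)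
  have hG : ∀ᵐ x, x ∈ averagePoints f := ae_tendsto_setAverage_shrink hloc
  set A : ℝ := 2 * (2 ^ n * K)
  have hA : 0 ≤ A := by positivity
  have hε' : 0 < ε / (4 * C) := by positivity
  obtain ⟨δ, hδ, hδ'⟩ := hsmall (ε / (4 * C) / (A + 1)) (by positivity)
  obtain ⟨R, hR⟩ := hlarge.exists_norm_sub_le_of_far hfar hω hK0 hK hloc hε'
  obtain ⟨g, hg, hgs, hfg⟩ := exists_contDiff_norm_sub_le hω hloc hG
    (M := A * max M₀ 0) (by positivity)
    (fun x hx y hy hxy => norm_sub_le_of_osc_le hω hK hloc hx hy hxy (le_max_right _ _)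
      fun c ℓ hℓ _ _ => hM c ℓ hℓ) hε' hδ
    (fun x hx y hy hxy hd => by
      refine (norm_sub_le_of_osc_le hω hK hloc hx hy hxy (E := ε / (4 * C) / (A + 1))
        (by positivity) fun c ℓ hℓ hle _ => hδ' c ℓ hℓ (hle.trans_lt hd)).trans ?_
      have := hω.1 _ (norm_pos_iff.2 (sub_ne_zero.2 hxy))
      gcongr
      rw [mul_div_assoc', div_le_iff₀ (by positivity)]
      nlinarith) hR
  refine ⟨g, hg, hgs, fun c ℓ hℓ => osc_le_of_norm_sub_le hω
    (hloc.sub hg.continuous.locallyIntegrable) hG hℓ fun x hx y hy hxc hyc => ?_⟩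
  have hωℓ := hω.1 ℓ hℓ
  by_cases hxy : x = y
  · rw [hxy, sub_self, norm_zero]
    positivity
  have hn : ‖x - y‖ ≤ 2 ^ n * ℓ := by
    refine (norm_sub_le_of_mem_cube hxc hyc hℓ.le).trans ?_
    gcongr
    exact_mod_cast Nat.lt_two_pow_self.le
  calc ‖(f x - g x) - (f y - g y)‖ ≤ 4 * (ε / (4 * C)) * ω ‖x - y‖ := hfg x hx y hy hxy
    _ ≤ 4 * (ε / (4 * C)) * (C * ω ℓ) := by
        gcongr
        exact (hω.2.1 _ _ (norm_pos_iff.2 (sub_ne_zero.2 hxy)) hn).trans (hCω ℓ hℓ)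
    _ = ε * ω ℓ := by field_simp
end

section
/- Let X and Y be arbitrary normed spaces, and let ω : (0,∞) → (0,∞) be non-decreasing, doubling (ω(2t) ≤ C_db·ω(t) for all t > 0, with C_db > 1), and satisfy ω(t) → 0 as t → 0 and ω(t) → ∞ as t → ∞. Then VC^{0,ω}_far(X,Y) equals the set of f ∈ Ċ^{0,ω}(X,Y) satisfying lim_{δ→∞} sup_{max(‖x‖,‖y‖)>δ, x≠y} ‖f(x)−f(y)‖/ω(‖x−y‖) = 0. -/
open Filter Set

/-- A smallness bound for pairs of far-away points extends to pairs with one very far point: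
the radial projection of that point to the sphere of radius `r + 1` is an intermediate point. -/
theorem HolderFinite.exists_far_near_bound
    {X Y : Type*} [NormedAddCommGroup X] [NormedSpace ℝ X] [NormedAddCommGroup Y]
    {ω : ℝ → ℝ} {f : X → Y}
    (hmono : ∀ s t : ℝ, 0 < s → s ≤ t → ω s ≤ ω t)
    (hpos : ∀ t : ℝ, 0 < t → 0 < ω t)
    (htop : Tendsto ω atTop atTop) (hf : HolderFinite ω f)
    {ε r : ℝ} (hε : 0 < ε) (hr : 0 < r)
    (hfar : ∀ x y : X, x ≠ y → r < ‖x‖ → r < ‖y‖ → ‖f x - f y‖ ≤ ε * ω ‖x - y‖) :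
    ∃ δ : ℝ, r < δ ∧ ∀ x y : X, δ < ‖x‖ → ‖y‖ ≤ r → ‖f x - f y‖ ≤ 2 * ε * ω ‖x - y‖ := by
  obtain ⟨M, hM⟩ := hf
  obtain ⟨T, hT⟩ := eventually_atTop.1 (htop.eventually_ge_atTop (|M| * ω (2 * r + 1) / ε))
  refine ⟨max (r + 1) (T + r), lt_max_of_lt_left (by linarith), fun x y hx hy => ?_⟩
  obtain ⟨hx1, hx2⟩ := max_lt_iff.1 hx
  have hx0 : 0 < ‖x‖ := by linarith
  set z : X := ((r + 1) / ‖x‖) • x with hz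
  have hznorm : ‖z‖ = r + 1 := by
    rw [hz, norm_smul, Real.norm_of_nonneg (by positivity)]
    field_simp
  have hxz : ‖x - z‖ = ‖x‖ - (r + 1) := by
    have h : x - z = (1 - (r + 1) / ‖x‖) • x := by rw [sub_smul, one_smul]
    have h1 : (r + 1) / ‖x‖ ≤ 1 := (div_le_one hx0).2 hx1.le
    rw [h, norm_smul, Real.norm_of_nonneg (by linarith)]
    field_simp
  have hne : x ≠ z := fun h => by
    rw [← h] at hznorm
    linarith
  have hzy : z ≠ y := fun h => by
    rw [h] at hznorm
    linarith
  have hxy : ‖x‖ - ‖y‖ ≤ ‖x - y‖ := norm_sub_norm_le x y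
  have hfz : ‖f x - f z‖ ≤ ε * ω ‖x - y‖ := by
    refine (hfar x z hne (by linarith) (by linarith)).trans ?_
    exact mul_le_mul_of_nonneg_left (hmono _ _ (by linarith) (by linarith)) hε.le
  have hzy_norm : ‖z - y‖ ≤ 2 * r + 1 := (norm_sub_le z y).trans (by linarith)
  have hzy_pos : 0 < ‖z - y‖ := norm_pos_iff.2 (sub_ne_zero.2 hzy)
  have hfy : ‖f z - f y‖ ≤ ε * ω ‖x - y‖ := by
    have h := hT ‖x - y‖ (by linarith)
    rw [div_le_iff₀ hε] at h
    calc ‖f z - f y‖ ≤ M * ω ‖z - y‖ := hM z y hzy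
      _ ≤ |M| * ω ‖z - y‖ := mul_le_mul_of_nonneg_right (le_abs_self M) (hpos _ hzy_pos).le
      _ ≤ |M| * ω (2 * r + 1) :=
        mul_le_mul_of_nonneg_left (hmono _ _ hzy_pos hzy_norm) (abs_nonneg M)
      _ ≤ ε * ω ‖x - y‖ := by linarith
  calc ‖f x - f y‖ ≤ ‖f x - f z‖ + ‖f z - f y‖ := norm_sub_le_norm_sub_add_norm_sub _ _ _
    _ ≤ 2 * ε * ω ‖x - y‖ := by linarith

/-- Lemma 2.2: `VC^{0,ω}_far(X,Y)` coincides with the class defined with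
`max(‖x‖,‖y‖) > δ` in place of `min(‖x‖,‖y‖) > δ`. -/
theorem vcfar_eq_max_version
    {X Y : Type*} [NormedAddCommGroup X] [NormedSpace ℝ X]
    [NormedAddCommGroup Y] [NormedSpace ℝ Y]
    (ω : ℝ → ℝ)
    (hpos : ∀ t : ℝ, 0 < t → 0 < ω t)
    (hmono : ∀ s t : ℝ, 0 < s → s ≤ t → ω s ≤ ω t)
    (hdb : ∃ Cdb : ℝ, 1 < Cdb ∧ ∀ t : ℝ, 0 < t → ω (2 * t) ≤ Cdb * ω t)
    (hzero : Filter.Tendsto ω (nhdsWithin 0 (Ioi 0)) (nhds 0))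
    (htop : Filter.Tendsto ω Filter.atTop Filter.atTop)
    (f : X → Y) :
    VCfar ω f ↔
      (HolderFinite ω f ∧
        ∀ ε : ℝ, 0 < ε → ∃ δ : ℝ, 0 < δ ∧ ∀ x y : X, x ≠ y → δ < max ‖x‖ ‖y‖ →
          ‖f x - f y‖ ≤ ε * ω ‖x - y‖) := by
  refine ⟨fun ⟨hf, hfar⟩ => ⟨hf, fun ε hε => ?_⟩, fun ⟨hf, hmax⟩ => ⟨hf, fun ε hε => ?_⟩⟩
  · obtain ⟨r, hr, hfar⟩ := hfar (ε / 2) (half_pos hε)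
    obtain ⟨δ, hδ, hnear⟩ :=
      hf.exists_far_near_bound hmono hpos htop (half_pos hε) hr hfar
    rw [mul_div_cancel₀ ε two_ne_zero] at hnear
    refine ⟨δ, hr.trans hδ, fun x y hxy hmax => ?_⟩
    have hω := hpos ‖x - y‖ (norm_pos_iff.2 (sub_ne_zero.2 hxy))
    rcases le_or_gt ‖y‖ r with hy | hy
    · exact hnear x y ((lt_max_iff.1 hmax).resolve_right (by linarith)) hy
    rcases le_or_gt ‖x‖ r with hx | hx
    · rw [norm_sub_rev (f x), norm_sub_rev x]
      exact hnear y x ((lt_max_iff.1 hmax).resolve_left (by linarith)) hx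
    · exact (hfar x y hxy hx hy).trans (by nlinarith)
  · obtain ⟨δ, hδ, h⟩ := hmax ε hε
    exact ⟨δ, hδ, fun x y hxy hx _ => h x y hxy (lt_max_of_lt_left hx)⟩
end

section
/- Let X and Y be arbitrary normed spaces, let ω : (0,∞) → (0,∞) be non-decreasing and doubling (ω(2t) ≤ C_db·ω(t) for all t > 0, with C_db > 1), and let τ : X → X be Lipschitz. Then for every f ∈ VC^{0,ω}_small(X,Y), the composition f ∘ τ belongs to VC^{0,ω}_small(X,Y). -/
open Filter Set

/-- Iterating the doubling inequality. -/
theorem doubling_pow {ω : ℝ → ℝ} {C : ℝ} (hC : 0 ≤ C)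
    (hdb : ∀ t : ℝ, 0 < t → ω (2 * t) ≤ C * ω t) (n : ℕ) {t : ℝ} (ht : 0 < t) :
    ω (2 ^ n * t) ≤ C ^ n * ω t := by
  induction n with
  | zero => simp
  | succ n ih =>
    calc ω (2 ^ (n + 1) * t) = ω (2 * (2 ^ n * t)) := by ring_nf
      _ ≤ C * ω (2 ^ n * t) := hdb _ (by positivity)
      _ ≤ C * (C ^ n * ω t) := mul_le_mul_of_nonneg_left ih hC
      _ = C ^ (n + 1) * ω t := by ring

/-- A Lipschitz map distorts a doubling modulus of continuity by at most a constant factor. -/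
theorem exists_modulus_le_of_lipschitz {X : Type*} [NormedAddCommGroup X] {ω : ℝ → ℝ}
    (hmono : ∀ s t : ℝ, 0 < s → s ≤ t → ω s ≤ ω t)
    (hdb : ∃ C : ℝ, 1 < C ∧ ∀ t : ℝ, 0 < t → ω (2 * t) ≤ C * ω t)
    {τ : X → X} (hτ : ∃ L, LipschitzWith L τ) :
    ∃ K D : ℝ, 0 < K ∧ 0 < D ∧ ∀ x y : X, ‖τ x - τ y‖ ≤ K * ‖x - y‖ ∧
      (τ x ≠ τ y → ω ‖τ x - τ y‖ ≤ D * ω ‖x - y‖) := by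
  obtain ⟨C, hC, hdb⟩ := hdb
  obtain ⟨L, hL⟩ := hτ
  obtain ⟨n, hn⟩ := pow_unbounded_of_one_lt (L : ℝ) one_lt_two
  have hC0 : 0 < C := by linarith
  refine ⟨2 ^ n, C ^ n, by positivity, by positivity, fun x y => ?_⟩
  have hle : ‖τ x - τ y‖ ≤ 2 ^ n * ‖x - y‖ := (hL.norm_sub_le x y).trans (by gcongr)
  refine ⟨hle, fun hne => ?_⟩
  have hxy : x ≠ y := fun h => hne (congrArg τ h)
  exact (hmono _ _ (norm_sub_pos_iff.2 hne) hle).trans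
    (doubling_pow hC0.le hdb n (norm_sub_pos_iff.2 hxy))

/-- Lemma 2.3: precomposition with a Lipschitz map preserves `VC^{0,ω}_small(X,Y)`. -/
theorem vcsmall_comp_lipschitz
    {X Y : Type*} [NormedAddCommGroup X] [NormedSpace ℝ X]
    [NormedAddCommGroup Y] [NormedSpace ℝ Y]
    (ω : ℝ → ℝ)
    (hpos : ∀ t : ℝ, 0 < t → 0 < ω t)
    (hmono : ∀ s t : ℝ, 0 < s → s ≤ t → ω s ≤ ω t)
    (hdb : ∃ Cdb : ℝ, 1 < Cdb ∧ ∀ t : ℝ, 0 < t → ω (2 * t) ≤ Cdb * ω t)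
    (τ : X → X) (hτ : ∃ L, LipschitzWith L τ)
    (f : X → Y) (hf : VCsmall ω f) :
    VCsmall ω (f ∘ τ) := by
  obtain ⟨K, D, hK, hD, hKD⟩ := exists_modulus_le_of_lipschitz hmono hdb hτ
  have key : ∀ {M : ℝ} {x y : X}, 0 ≤ M → x ≠ y →
      (τ x ≠ τ y → ‖f (τ x) - f (τ y)‖ ≤ M * ω ‖τ x - τ y‖) →
      ‖f (τ x) - f (τ y)‖ ≤ M * D * ω ‖x - y‖ := by
    intro M x y hM hxy h
    by_cases hne : τ x = τ y
    · have := hpos _ (norm_sub_pos_iff.2 hxy)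
      rw [hne, sub_self, norm_zero]
      positivity
    · rw [mul_assoc]
      exact (h hne).trans (mul_le_mul_of_nonneg_left ((hKD x y).2 hne) hM)
  obtain ⟨⟨M, hM⟩, hsmall⟩ := hf
  refine ⟨⟨|M| * D, fun x y hxy => key (abs_nonneg M) hxy fun hne => ?_⟩, fun ε hε => ?_⟩
  · exact (hM _ _ hne).trans
      (mul_le_mul_of_nonneg_right (le_abs_self M) (hpos _ (norm_sub_pos_iff.2 hne)).le)
  · obtain ⟨δ, hδ, hf⟩ := hsmall (ε / D) (by positivity)
    refine ⟨δ / K, by positivity, fun x y hxy hlt => ?_⟩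
    have hτlt : ‖τ x - τ y‖ < δ := (hKD x y).1.trans_lt ((lt_div_iff₀' hK).1 hlt)
    have := key (by positivity) hxy fun hne => hf _ _ hne hτlt
    rwa [div_mul_cancel₀ _ hD.ne'] at this
end

section
/- Let X be a normed space, ω an admissible modulus, and f ∈ VC^{0,ω}_small(X,ℝ). Then there exists a sequence (f_n) of real-valued Lipschitz functions on X converging to f in the Ċ^{0,ω}(X,ℝ) seminorm (i.e., ‖f_n − f‖_{Ċ^{0,ω}} → 0). Moreover, if f has bounded support, the sequence can be taken to consist of Lipschitz functions with bounded support. -/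
open Filter Set

/-- A function on a normed space that oscillates by at most `K` at scale `t` has at most
linear growth at large scales. -/
theorem abs_sub_le_of_oscillation_le {X : Type*} [NormedAddCommGroup X] [NormedSpace ℝ X]
    {f : X → ℝ} {K t : ℝ} (hK : 0 ≤ K) (ht : 0 < t)
    (h : ∀ x y : X, ‖x - y‖ ≤ t → |f x - f y| ≤ K) (x y : X) :
    |f x - f y| ≤ K + K / t * ‖x - y‖ := by
  have key : ∀ (n : ℕ) (x y : X), ‖x - y‖ ≤ n * t → |f x - f y| ≤ n * K := by
    intro n
    induction n with
    | zero =>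
      intro x y hxy
      have : x = y := by
        rw [← sub_eq_zero, ← norm_le_zero_iff]
        simpa using hxy
      simp [this]
    | succ n ih =>
      intro x y hxy
      push_cast at hxy ⊢
      have hn : (0 : ℝ) < n + 1 := by positivity
      set z : X := y + ((n : ℝ) / (n + 1)) • (x - y) with hz
      have h1 : x - z = ((1 : ℝ) / (n + 1)) • (x - y) := by
        have : (1 : ℝ) / (n + 1) = 1 - n / (n + 1) := by field_simp; ring
        rw [this, sub_smul, one_smul, hz]
        abel
      have h2 : z - y = ((n : ℝ) / (n + 1)) • (x - y) := by
        rw [hz]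
        abel
      have h3 : ‖x - z‖ ≤ t := by
        rw [h1, norm_smul, Real.norm_of_nonneg (by positivity), div_mul_eq_mul_div,
          div_le_iff₀ hn]
        linarith
      have h4 : ‖z - y‖ ≤ n * t := by
        rw [h2, norm_smul, Real.norm_of_nonneg (by positivity), div_mul_eq_mul_div,
          div_le_iff₀ hn]
        have := mul_le_mul_of_nonneg_left hxy (Nat.cast_nonneg (α := ℝ) n)
        linarith
      have h5 := abs_sub_le (f x) (f z) (f y)
      linarith [h x z h3, ih z y h4]
  have h1 : ‖x - y‖ ≤ ⌈‖x - y‖ / t⌉₊ * t := by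
    rw [← div_le_iff₀ ht]
    exact Nat.le_ceil _
  have h2 : (⌈‖x - y‖ / t⌉₊ : ℝ) ≤ ‖x - y‖ / t + 1 :=
    (Nat.ceil_lt_add_one (by positivity)).le
  calc |f x - f y| ≤ ⌈‖x - y‖ / t⌉₊ * K := key _ x y h1
    _ ≤ (‖x - y‖ / t + 1) * K := mul_le_mul_of_nonneg_right h2 hK
    _ = K + K / t * ‖x - y‖ := by ring

/-- The infimal convolution of `f` with `L * ‖·‖`. -/
noncomputable def lipschitzEnvelope {X : Type*} [NormedAddCommGroup X] (f : X → ℝ) (L : ℝ)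
    (x : X) : ℝ :=
  ⨅ y, (f y + L * ‖x - y‖)

section lipschitzEnvelope

variable {X : Type*} [NormedAddCommGroup X] {f : X → ℝ} {K L : ℝ}

theorem lipschitzEnvelope_le (h : ∀ x y : X, |f x - f y| ≤ K + L * ‖x - y‖) (x y : X) :
    lipschitzEnvelope f L x ≤ f y + L * ‖x - y‖ := by
  refine ciInf_le ⟨f x - K, ?_⟩ y
  rintro _ ⟨z, rfl⟩
  have := (abs_le.1 (h x z)).2
  simp only
  linarith

theorem lipschitzEnvelope_le_self (h : ∀ x y : X, |f x - f y| ≤ K + L * ‖x - y‖) (x : X) :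
    lipschitzEnvelope f L x ≤ f x := by
  simpa using lipschitzEnvelope_le h x x

theorem sub_le_lipschitzEnvelope (h : ∀ x y : X, |f x - f y| ≤ K + L * ‖x - y‖) (x : X) :
    f x - K ≤ lipschitzEnvelope f L x := by
  refine le_ciInf fun y => ?_
  have := (abs_le.1 (h x y)).2
  linarith

theorem lipschitzWith_lipschitzEnvelope (hL : 0 ≤ L)
    (h : ∀ x y : X, |f x - f y| ≤ K + L * ‖x - y‖) :
    LipschitzWith L.toNNReal (lipschitzEnvelope f L) := by
  refine LipschitzWith.of_le_add_mul _ fun x y => ?_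
  rw [← sub_le_iff_le_add]
  refine le_ciInf fun z => ?_
  have h1 := lipschitzEnvelope_le h x z
  have h2 : ‖x - z‖ ≤ dist x y + ‖y - z‖ := by
    rw [dist_eq_norm]
    exact norm_sub_le_norm_sub_add_norm_sub x y z
  have h3 := mul_le_mul_of_nonneg_left h2 hL
  rw [Real.coe_toNNReal L hL]
  linarith

/-- The envelope inherits every translation-invariant bound on increments. -/
theorem abs_lipschitzEnvelope_sub_le (h : ∀ x y : X, |f x - f y| ≤ K + L * ‖x - y‖)
    {x y : X} {M : ℝ} (hM : ∀ z w : X, z - w = x - y → |f z - f w| ≤ M) :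
    |lipschitzEnvelope f L x - lipschitzEnvelope f L y| ≤ M := by
  rw [abs_sub_le_iff]
  constructor
  · rw [sub_le_comm]
    refine le_ciInf fun z => ?_
    have h1 := lipschitzEnvelope_le h x (z + (x - y))
    have h2 := (abs_le.1 (hM (z + (x - y)) z (by abel))).2
    rw [show x - (z + (x - y)) = y - z by abel] at h1
    linarith
  · rw [sub_le_comm]
    refine le_ciInf fun z => ?_
    have h1 := lipschitzEnvelope_le h y (z - (x - y))
    have h2 := (abs_le.1 (hM z (z - (x - y)) (by abel))).1
    rw [show y - (z - (x - y)) = x - z by abel] at h1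
    linarith

end lipschitzEnvelope

theorem BddSupp.lipschitzEnvelope {X : Type*} [NormedAddCommGroup X] {f : X → ℝ} {K L : ℝ}
    (hf : BddSupp f) (hL : 0 < L) (h : ∀ x y : X, |f x - f y| ≤ K + L * ‖x - y‖) :
    BddSupp (lipschitzEnvelope f L) := by
  obtain ⟨R, hR⟩ := hf
  refine ⟨max R (R + (|f 0| + K + L * R) / L), fun x hx => ?_⟩
  obtain ⟨hx1, hx2⟩ := max_lt_iff.1 hx
  refine le_antisymm ((lipschitzEnvelope_le_self h x).trans_eq (hR x hx1)) ?_
  refine le_ciInf fun y => ?_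
  rcases lt_or_ge R ‖y‖ with hy | hy
  · rw [hR y hy]
    positivity
  · have h1 := (abs_le.1 (h 0 y)).2
    rw [zero_sub, norm_neg] at h1
    have h2 := neg_abs_le (f 0)
    have h3 := mul_le_mul_of_nonneg_left hy hL.le
    have h4 : (|f 0| + K + L * R) / L ≤ ‖x - y‖ := by
      linarith [norm_sub_norm_le x y]
    rw [div_le_iff₀' hL] at h4
    linarith

theorem VCsmall.exists_lipschitz_holderLE {X : Type*} [NormedAddCommGroup X] [NormedSpace ℝ X]
    {ω : ℝ → ℝ} (hpos : ∀ t : ℝ, 0 < t → 0 < ω t)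
    (hmono : ∀ s t : ℝ, 0 < s → s ≤ t → ω s ≤ ω t)
    {f : X → ℝ} (hf : VCsmall ω f) {ε : ℝ} (hε : 0 < ε) :
    ∃ g : X → ℝ, (∃ L, LipschitzWith L g) ∧ (BddSupp f → BddSupp g) ∧
      HolderLE ω (fun x => f x - g x) ε := by
  obtain ⟨δ, hδ, hsmall⟩ := hf.2 (ε / 2) (half_pos hε)
  set t := δ / 2 with ht_def
  have ht : 0 < t := half_pos hδ
  set K := ε / 2 * ω t with hK_def
  have hK : 0 < K := mul_pos (half_pos hε) (hpos t ht)
  have hosc : ∀ x y : X, ‖x - y‖ ≤ t → |f x - f y| ≤ K := by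
    intro x y hxy
    rcases eq_or_ne x y with rfl | hne
    · simpa using hK.le
    · have hr : 0 < ‖x - y‖ := norm_pos_iff.2 (sub_ne_zero.2 hne)
      exact (hsmall x y hne (by linarith)).trans
        (mul_le_mul_of_nonneg_left (hmono _ _ hr hxy) (half_pos hε).le)
  have hL : 0 < K / t := div_pos hK ht
  have h := abs_sub_le_of_oscillation_le hK.le ht hosc
  refine ⟨lipschitzEnvelope f (K / t), ⟨_, lipschitzWith_lipschitzEnvelope hL.le h⟩,
    fun hb => hb.lipschitzEnvelope hL h, fun x y hne => ?_⟩
  have hr : 0 < ‖x - y‖ := norm_pos_iff.2 (sub_ne_zero.2 hne)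
  have hω := mul_pos (half_pos hε) (hpos _ hr)
  rw [Real.norm_eq_abs, abs_le]
  rcases lt_or_ge ‖x - y‖ δ with hlt | hge
  · have h1 := abs_le.1 (hsmall x y hne hlt)
    have h2 := abs_le.1 (abs_lipschitzEnvelope_sub_le h (x := x) (y := y)
      (M := ε / 2 * ω ‖x - y‖) fun z w hzw => by
        rw [← hzw] at hlt hr ⊢
        exact hsmall z w (sub_ne_zero.1 (norm_pos_iff.1 hr)) hlt)
    constructor <;> linarith [h1.1, h1.2, h2.1, h2.2]
  · have h1 : K ≤ ε / 2 * ω ‖x - y‖ :=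
      mul_le_mul_of_nonneg_left (hmono _ _ ht (by linarith)) (half_pos hε).le
    constructor <;> linarith [lipschitzEnvelope_le_self h x, lipschitzEnvelope_le_self h y,
      sub_le_lipschitzEnvelope h x, sub_le_lipschitzEnvelope h y]

/-- Lemma 3.1: every `f ∈ VC^{0,ω}_small(X,ℝ)` is the `Ċ^{0,ω}`-limit of a sequence of
Lipschitz functions; if moreover `f` has bounded support, the approximating Lipschitz
functions can be taken with bounded support. -/
theorem vcsmall_lipschitz_approx
    {X : Type*} [NormedAddCommGroup X] [NormedSpace ℝ X]
    (ω : ℝ → ℝ) (hω : Admissible ω)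
    (f : X → ℝ) (hf : VCsmall ω f) :
    (∃ g : ℕ → X → ℝ,
      (∀ m : ℕ, ∃ L, LipschitzWith L (g m)) ∧
      (∀ ε : ℝ, 0 < ε → ∃ N : ℕ, ∀ m : ℕ, N ≤ m →
        HolderLE ω (fun x => f x - g m x) ε)) ∧
    (BddSupp f → ∃ g : ℕ → X → ℝ,
      (∀ m : ℕ, (∃ L, LipschitzWith L (g m)) ∧ BddSupp (g m)) ∧
      (∀ ε : ℝ, 0 < ε → ∃ N : ℕ, ∀ m : ℕ, N ≤ m →
        HolderLE ω (fun x => f x - g m x) ε)) := by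
  obtain ⟨hpos, hmono, -⟩ := hω
  choose g hLip hsupp hle using fun m : ℕ =>
    hf.exists_lipschitz_holderLE hpos hmono (Nat.one_div_pos_of_nat (α := ℝ) (n := m))
  have hconv : ∀ ε : ℝ, 0 < ε → ∃ N : ℕ, ∀ m : ℕ, N ≤ m →
      HolderLE ω (fun x => f x - g m x) ε := by
    intro ε hε
    obtain ⟨N, hN⟩ := exists_nat_one_div_lt hε
    refine ⟨N, fun m hm x y hne => (hle m x y hne).trans ?_⟩
    exact mul_le_mul_of_nonneg_right ((Nat.one_div_le_one_div hm).trans hN.le)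
      (hpos _ (norm_pos_iff.2 (sub_ne_zero.2 hne))).le
  exact ⟨⟨g, hLip, hconv⟩, fun hb => ⟨g, fun m => ⟨hLip m, hsupp m hb⟩, hconv⟩⟩
end

section
/- Let X be a normed space and ω an admissible modulus. Let f : X → ℝ and let (f_n) be a sequence of Lipschitz functions on X such that limsup_n Lip(f_n) < ∞ and f_n converges to f uniformly on X. Then ‖f_n − f‖_{Ċ^{0,ω}(X,ℝ)} → 0 as n → ∞. -/
open Filter Set

/-- Lemma 3.2: a sequence of Lipschitz functions with uniformly bounded Lipschitz constants
(eventually) which converges uniformly also converges in the `Ċ^{0,ω}` seminorm. -/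
theorem lipschitz_uniform_to_holder_approx
    {X : Type*} [NormedAddCommGroup X] [NormedSpace ℝ X]
    (ω : ℝ → ℝ) (hω : Admissible ω)
    (f : X → ℝ) (g : ℕ → X → ℝ)
    (hLip : ∀ m : ℕ, ∃ L, LipschitzWith L (g m))
    (hlimsup : ∃ L : NNReal, ∃ N : ℕ, ∀ m : ℕ, N ≤ m → LipschitzWith L (g m))
    (hunif : TendstoUniformly g f Filter.atTop) :
    ∀ ε : ℝ, 0 < ε → ∃ N : ℕ, ∀ m : ℕ, N ≤ m →
      HolderLE ω (fun x => g m x - f x) ε := by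
  obtain ⟨hpos, hmono, -, -, hsmall, -⟩ := hω
  obtain ⟨L, N₀, hL⟩ := hlimsup
  intro ε hε
  have hf : LipschitzWith L f := by
    refine LipschitzWith.of_dist_le_mul fun x y => ?_
    refine le_of_tendsto ((hunif.tendsto_at x).dist (hunif.tendsto_at y)) ?_
    filter_upwards [eventually_ge_atTop N₀] with m hm
    exact (hL m hm).dist_le_mul x y
  have hK : (0 : ℝ) < 2 * L + 1 := by positivity
  obtain ⟨δ, hδ, hδω⟩ := Metric.tendsto_nhdsWithin_nhds.1 hsmall (ε / (2 * L + 1)) (by positivity)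
  have hη : 0 < ε * ω δ / 2 := by have := hpos δ hδ; positivity
  obtain ⟨N₁, hN₁⟩ := eventually_atTop.1 (Metric.tendstoUniformly_iff.1 hunif _ hη)
  refine ⟨max N₀ N₁, fun m hm x y hxy => ?_⟩
  have ht : 0 < ‖x - y‖ := norm_pos_iff.2 (sub_ne_zero.2 hxy)
  rcases lt_or_ge ‖x - y‖ δ with h | h
  · have hg := (hL m (le_trans (le_max_left _ _) hm)).dist_le_mul x y
    have hfxy := hf.dist_le_mul x y
    have hω_pos := hpos _ ht
    have hquot := hδω (mem_Ioi.2 ht) (by rwa [dist_zero_right, norm_norm])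
    rw [dist_zero_right, Real.norm_of_nonneg (by positivity), div_lt_div_iff₀ hω_pos hK] at hquot
    rw [dist_eq_norm x y, Real.dist_eq] at hg hfxy
    rw [Real.norm_eq_abs]
    rw [abs_le] at hg hfxy ⊢
    constructor <;> linarith [hg.1, hg.2, hfxy.1, hfxy.2]
  · have hx := hN₁ m (le_trans (le_max_right _ _) hm) x
    have hy := hN₁ m (le_trans (le_max_right _ _) hm) y
    have hle := mul_le_mul_of_nonneg_left (hmono δ _ hδ h) hε.le
    rw [Real.dist_eq, abs_lt] at hx hy
    rw [Real.norm_eq_abs, abs_le]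
    constructor <;> linarith [hx.1, hx.2, hy.1, hy.2]
end

section
/- Let X be a normed space and ω an admissible modulus. Then: (i) the closure, in the Ċ^{0,ω}(X,ℝ) seminorm, of the set of Lipschitz functions belonging to Ċ^{0,ω}(X,ℝ) equals VC^{0,ω}_small(X,ℝ); and (ii) the closure, in the Ċ^{0,ω}(X,ℝ) seminorm, of the set of Lipschitz functions on X with bounded support equals VC^{0,ω}(X,ℝ). -/
open Filter Set

section LipschitzApproximation

variable {X : Type*} [NormedAddCommGroup X]

/-- Enlarging the constant, a Hölder bound may be assumed nonnegative. -/
lemma HolderFinite.exists_nonneg {ω : ℝ → ℝ} (hpos : ∀ t : ℝ, 0 < t → 0 < ω t) {f : X → ℝ}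
    (hf : HolderFinite ω f) : ∃ M : ℝ, 0 ≤ M ∧ HolderLE ω f M := by
  obtain ⟨M, hM⟩ := hf
  refine ⟨|M|, abs_nonneg M, fun x y hxy => (hM x y hxy).trans ?_⟩
  exact mul_le_mul_of_nonneg_right (le_abs_self M)
    (hpos _ (norm_pos_iff.2 (sub_ne_zero.2 hxy))).le

/-- Linear growth of Hölder functions at scales that are multiples of `r`, by chaining. -/
lemma HolderLE.norm_sub_le_nat_mul [NormedSpace ℝ X] {ω : ℝ → ℝ}
    (hpos : ∀ t : ℝ, 0 < t → 0 < ω t) (hmono : ∀ s t : ℝ, 0 < s → s ≤ t → ω s ≤ ω t)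
    {f : X → ℝ} {M : ℝ} (hM : 0 ≤ M) (hf : HolderLE ω f M) {r : ℝ} (hr : 0 < r) (n : ℕ)
    (x y : X) (hxy : ‖x - y‖ ≤ n * r) : ‖f x - f y‖ ≤ n * (M * ω r) := by
  induction n generalizing x with
  | zero =>
    have h0 : x = y := by
      rw [← sub_eq_zero, ← norm_le_zero_iff]
      simpa using hxy
    simp [h0]
  | succ n ih =>
    have hn : (0 : ℝ) < n + 1 := by positivity
    push_cast at hxy ⊢
    set w : X := x - (1 / ((n : ℝ) + 1)) • (x - y) with hw
    have h1 : ‖x - w‖ ≤ r := by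
      have : x - w = (1 / ((n : ℝ) + 1)) • (x - y) := by rw [hw]; abel
      rw [this, norm_smul, Real.norm_of_nonneg (by positivity), one_div, inv_mul_le_iff₀ hn]
      exact hxy
    have h2 : ‖w - y‖ ≤ n * r := by
      have h3 : w - y = ((n : ℝ) / (n + 1)) • (x - y) := by
        have : ((n : ℝ) / (n + 1)) = 1 - 1 / ((n : ℝ) + 1) := by field_simp; ring
        rw [this, sub_smul, one_smul, hw]; abel
      rw [h3, norm_smul, Real.norm_of_nonneg (by positivity), div_mul_eq_mul_div,
        div_le_iff₀ hn]
      have := mul_le_mul_of_nonneg_left hxy (Nat.cast_nonneg (α := ℝ) n)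
      linarith
    have h4 : ‖f x - f w‖ ≤ M * ω r := by
      rcases eq_or_ne x w with h | h
      · rw [← h]
        simpa using mul_nonneg hM (hpos r hr).le
      · exact (hf x w h).trans (mul_le_mul_of_nonneg_left
          (hmono _ _ (norm_pos_iff.2 (sub_ne_zero.2 h)) h1) hM)
    calc ‖f x - f y‖ ≤ ‖f x - f w‖ + ‖f w - f y‖ := norm_sub_le_norm_sub_add_norm_sub _ _ _
      _ ≤ M * ω r + n * (M * ω r) := add_le_add h4 (ih w h2)
      _ = (n + 1) * (M * ω r) := by ring

/-- The inf-convolution of `f` with the cone `L‖·‖`. -/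
noncomputable def infConv (f : X → ℝ) (L : ℝ) (x : X) : ℝ :=
  ⨅ z : X, f (x + z) + L * ‖z‖

lemma infConv_le {f : X → ℝ} {L B : ℝ} (hB : ∀ x z : X, f x - B ≤ f (x + z) + L * ‖z‖)
    (x z : X) : infConv f L x ≤ f (x + z) + L * ‖z‖ :=
  ciInf_le ⟨f x - B, by rintro _ ⟨z, rfl⟩; exact hB x z⟩ z

lemma abs_sub_infConv_le {f : X → ℝ} {L B : ℝ}
    (hB : ∀ x z : X, f x - B ≤ f (x + z) + L * ‖z‖) (x : X) : |f x - infConv f L x| ≤ B := by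
  have h1 : f x - B ≤ infConv f L x := le_ciInf (hB x)
  have h2 := infConv_le hB x 0
  simp only [add_zero, norm_zero, mul_zero] at h2
  rw [abs_of_nonneg (by linarith)]
  linarith

lemma lipschitzWith_infConv {f : X → ℝ} {L : NNReal} {B : ℝ}
    (hB : ∀ x z : X, f x - B ≤ f (x + z) + L * ‖z‖) : LipschitzWith L (infConv f L) := by
  refine LipschitzWith.of_le_add_mul L fun x y => ?_
  rw [← sub_le_iff_le_add]
  refine le_ciInf fun z => ?_
  have h1 := infConv_le hB x (y - x + z)
  have h2 : x + (y - x + z) = y + z := by abel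
  have h3 : ‖y - x + z‖ ≤ dist x y + ‖z‖ := by
    rw [dist_comm, dist_eq_norm]; exact norm_add_le _ _
  have h4 := mul_le_mul_of_nonneg_left h3 L.coe_nonneg
  rw [h2] at h1
  linarith

/-- Inf-convolution commutes with translations, so it preserves moduli of continuity. -/
lemma norm_infConv_sub_le {f : X → ℝ} {L B : ℝ}
    (hB : ∀ x z : X, f x - B ≤ f (x + z) + L * ‖z‖) {x y : X} {c : ℝ}
    (hc : ∀ z : X, ‖f (x + z) - f (y + z)‖ ≤ c) : ‖infConv f L x - infConv f L y‖ ≤ c := by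
  rw [Real.norm_eq_abs, abs_sub_le_iff]
  constructor <;> rw [sub_le_comm] <;> refine le_ciInf fun z => ?_
  · have h1 := infConv_le hB x z
    have h2 := (abs_sub_le_iff.1 (hc z)).1
    linarith
  · have h1 := infConv_le hB y z
    have h2 := (abs_sub_le_iff.1 (hc z)).2
    linarith

/-- A Hölder function with small oscillation at small scales is close to a Lipschitz one. -/
lemma HolderFinite.exists_lipschitz_approx [NormedSpace ℝ X] {ω : ℝ → ℝ}
    (hpos : ∀ t : ℝ, 0 < t → 0 < ω t) (hmono : ∀ s t : ℝ, 0 < s → s ≤ t → ω s ≤ ω t)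
    {f : X → ℝ} (hf : HolderFinite ω f) {ε δ : ℝ} (hε : 0 < ε) (hδ : 0 < δ)
    (hsmall : ∀ x y : X, x ≠ y → ‖x - y‖ < δ → ‖f x - f y‖ ≤ ε * ω ‖x - y‖) :
    ∃ g : X → ℝ, (∃ L, LipschitzWith L g) ∧ HolderFinite ω g ∧
      HolderLE ω (fun x => f x - g x) (2 * ε) := by
  obtain ⟨M, hM, hfM⟩ := hf.exists_nonneg hpos
  have hωδ := hpos δ hδ
  set L : NNReal := ⟨2 * (M * ω δ) / δ, by positivity⟩ with hL
  have hLval : (L : ℝ) = 2 * (M * ω δ) / δ := rfl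
  have hB : ∀ x z : X, f x - ε * ω δ ≤ f (x + z) + L * ‖z‖ := by
    intro x z
    rcases lt_or_ge ‖z‖ δ with hz | hz
    · have h0 : 0 ≤ (L : ℝ) * ‖z‖ := by positivity
      rcases eq_or_ne z 0 with rfl | hz0
      · simp only [add_zero]
        have : 0 ≤ ε * ω δ := by positivity
        linarith
      · have h1 := hsmall x (x + z) (by simpa using hz0) (by simpa using hz)
        have h2 := hmono _ _ (norm_pos_iff.2 hz0) hz.le
        have h3 := mul_le_mul_of_nonneg_left h2 hε.le
        simp only [sub_add_cancel_left, norm_neg] at h1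
        have h4 := (le_abs_self _).trans h1
        linarith
    · have hn := Nat.le_ceil (‖z‖ / δ)
      have hn' := Nat.ceil_lt_add_one (a := ‖z‖ / δ) (by positivity)
      have h1 := hfM.norm_sub_le_nat_mul hpos hmono hM hδ ⌈‖z‖ / δ⌉₊ x (x + z)
        (by simpa using (div_le_iff₀ hδ).1 hn)
      have h2 : (1 : ℝ) ≤ ‖z‖ / δ := (one_le_div hδ).2 hz
      have h3 : (⌈‖z‖ / δ⌉₊ : ℝ) * (M * ω δ) ≤ 2 * (‖z‖ / δ) * (M * ω δ) :=
        mul_le_mul_of_nonneg_right (by linarith) (by positivity)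
      have h4 : 2 * (‖z‖ / δ) * (M * ω δ) = L * ‖z‖ := by rw [hLval]; ring
      have h5 := (le_abs_self _).trans h1
      have : 0 ≤ ε * ω δ := by positivity
      linarith
  have htrans : ∀ x y z : X, x + z - (y + z) = x - y := fun x y z => by abel
  refine ⟨infConv f L, ⟨L, lipschitzWith_infConv hB⟩, ⟨M, fun x y hxy => ?_⟩,
    fun x y hxy => ?_⟩
  · refine norm_infConv_sub_le hB fun z => ?_
    simpa only [htrans] using hfM (x + z) (y + z) (by simpa using hxy)
  · rcases lt_or_ge ‖x - y‖ δ with h | h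
    · have h1 := hsmall x y hxy h
      have h2 : ‖infConv f L x - infConv f L y‖ ≤ ε * ω ‖x - y‖ := by
        refine norm_infConv_sub_le hB fun z => ?_
        simpa only [htrans] using
          hsmall (x + z) (y + z) (by simpa using hxy) (by simpa only [htrans] using h)
      have h3 := norm_sub_le (f x - f y) (infConv f L x - infConv f L y)
      rw [sub_sub_sub_comm]
      linarith
    · have h1 := abs_sub_infConv_le hB x
      have h2 := abs_sub_infConv_le hB y
      have h3 := norm_sub_le (f x - infConv f L x) (f y - infConv f L y)
      have h4 := mul_le_mul_of_nonneg_left (hmono _ _ hδ h) hε.le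
      simp only [Real.norm_eq_abs] at h3 ⊢
      linarith

lemma Admissible.exists_le_mul {ω : ℝ → ℝ} (hω : Admissible ω) {ε : ℝ} (hε : 0 < ε) :
    ∃ δ : ℝ, 0 < δ ∧ ∀ t : ℝ, 0 < t → t < δ → t ≤ ε * ω t := by
  obtain ⟨hpos, -, -, -, hlim, -⟩ := hω
  have h := hlim.eventually (Iio_mem_nhds hε)
  obtain ⟨δ, hδ, hsub⟩ := mem_nhdsGT_iff_exists_Ioo_subset.1 h
  refine ⟨δ, hδ, fun t ht htδ => ?_⟩
  have h1 : t / ω t < ε := hsub ⟨ht, htδ⟩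
  exact ((div_lt_iff₀ (hpos t ht)).1 h1).le

/-- A flat enough cone of height `H` has small Hölder seminorm. -/
lemma Admissible.exists_slope {ω : ℝ → ℝ} (hω : Admissible ω) {ε H : ℝ} (hε : 0 < ε) :
    ∃ s₀ : ℝ, 0 < s₀ ∧ ∀ t : ℝ, 0 < t → s₀ * t ≤ ε * ω t ∨ H ≤ ε * ω t := by
  obtain ⟨τ, hτ, hτω⟩ := hω.exists_le_mul one_pos
  obtain ⟨hpos, hmono, -, hinf, -, -⟩ := hω
  obtain ⟨T, hT, hT0⟩ :=
    ((hinf.eventually_ge_atTop (H / ε)).and (eventually_gt_atTop 0)).exists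
  have hωτ := hpos τ hτ
  refine ⟨min ε (ε * ω τ / T), by positivity, fun t ht => ?_⟩
  rcases lt_or_ge t τ with h | h
  · left
    have h1 := hτω t ht h
    rw [one_mul] at h1
    exact mul_le_mul (min_le_left _ _) h1 ht.le hε.le
  rcases lt_or_ge t T with h' | h'
  · left
    calc min ε (ε * ω τ / T) * t ≤ ε * ω τ / T * T :=
          mul_le_mul (min_le_right _ _) h'.le ht.le (by positivity)
      _ = ε * ω τ := by field_simp
      _ ≤ ε * ω t := mul_le_mul_of_nonneg_left (hmono _ _ hτ h) hε.le
  · right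
    have := (div_le_iff₀' hε).1 (hT.trans (hmono _ _ hT0 h'))
    exact this

/-- Soft thresholding is `1`-Lipschitz in the function and in the threshold. -/
lemma abs_softThreshold_sub_le {a b p q : ℝ} (hp : 0 ≤ p) (hq : 0 ≤ q) :
    |(a - max (-p) (min p a)) - (b - max (-q) (min q b))| ≤ |a - b| + |p - q| := by
  grind

/-- On a segment from inside a ball to its outside there is a point on the sphere. -/
lemma exists_norm_eq_of_le_of_le [NormedSpace ℝ X] {x y : X} {R : ℝ} (hx : ‖x‖ ≤ R)
    (hy : R ≤ ‖y‖) : ∃ w : X, ‖w‖ = R ∧ ‖w - y‖ ≤ ‖x - y‖ := by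
  have hc : ContinuousOn (fun t : ℝ => ‖y + t • (x - y)‖) (Icc 0 1) := by fun_prop
  obtain ⟨t, ⟨ht0, ht1⟩, ht⟩ := intermediate_value_Icc' zero_le_one hc
    (show R ∈ Icc _ _ by simpa using ⟨hx, hy⟩)
  refine ⟨_, ht, ?_⟩
  rw [add_sub_cancel_left, norm_smul, Real.norm_of_nonneg ht0]
  exact mul_le_of_le_one_left (norm_nonneg _) ht1

/-- A Lipschitz function with small oscillation far away is close to a boundedly supported one. -/
lemma LipschitzWith.exists_bddSupp_approx [NormedSpace ℝ X] {ω : ℝ → ℝ} (hω : Admissible ω)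
    {g : X → ℝ} {L : NNReal} (hg : LipschitzWith L g) {ε δ : ℝ} (hε : 0 < ε) (hδ : 0 < δ)
    (hfar : ∀ x y : X, x ≠ y → δ < ‖x‖ → δ < ‖y‖ → ‖g x - g y‖ ≤ ε * ω ‖x - y‖) :
    ∃ k : X → ℝ, (∃ L, LipschitzWith L k) ∧ BddSupp k ∧
      HolderLE ω (fun x => g x - k x) (2 * ε) := by
  set H : ℝ := L * (2 * δ) + 1 with hH
  have hHpos : 0 < H := by positivity
  obtain ⟨s₀, hs₀, hslope⟩ := hω.exists_slope (H := H) hε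
  have hpos := hω.1
  have hmono := hω.2.1
  set s : ℝ := min s₀ (1 / (2 * δ)) with hs
  have hspos : 0 < s := by positivity
  have hsδ : s * (2 * δ) ≤ 1 := by
    rw [← le_div_iff₀ (by positivity)]; exact min_le_right _ _
  set h : X → ℝ := fun x => g x - g 0 with hh
  set ψ : X → ℝ := fun x => max (H - s * ‖x‖) 0 with hψ
  have hψ0 : ∀ x, 0 ≤ ψ x := fun x => le_max_right _ _
  have hψH : ∀ x, ψ x ≤ H := fun x => max_le (by have := norm_nonneg x; nlinarith) hHpos.le
  have hψlip : ∀ x y, |ψ x - ψ y| ≤ s * ‖x - y‖ := by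
    intro x y
    refine (abs_max_sub_max_le_abs _ _ _).trans ?_
    rw [sub_sub_sub_cancel_left, ← mul_sub, abs_mul, abs_of_pos hspos, norm_sub_rev]
    exact mul_le_mul_of_nonneg_left (abs_norm_sub_norm_le _ _) hspos.le
  have hψω : ∀ x y, x ≠ y → |ψ x - ψ y| ≤ ε * ω ‖x - y‖ := by
    intro x y hxy
    have ht := norm_pos_iff.2 (sub_ne_zero.2 hxy)
    rcases hslope _ ht with h1 | h1
    · exact (hψlip x y).trans
        ((mul_le_mul_of_nonneg_right (min_le_left _ _) ht.le).trans h1)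
    · refine le_trans ?_ h1
      rw [abs_sub_le_iff]
      constructor <;> linarith [hψ0 x, hψ0 y, hψH x, hψH y]
  have hψ_lipschitz : LipschitzWith ⟨s, hspos.le⟩ ψ :=
    LipschitzWith.of_dist_le_mul fun x y => by
      rw [Real.dist_eq, dist_eq_norm]; exact hψlip x y
  have hh_lipschitz : LipschitzWith L h := LipschitzWith.of_dist_le_mul fun x y => by
    simpa [hh, dist_eq_norm] using hg.dist_le_mul x y
  set k : X → ℝ := fun x => max (-ψ x) (min (ψ x) (h x)) with hk
  set e : X → ℝ := fun x => h x - k x with he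
  have hnear : ∀ x, ‖x‖ ≤ 2 * δ → e x = 0 := by
    intro x hx
    have h1 : |h x| ≤ L * ‖x‖ := by
      simpa [hh, dist_eq_norm] using hg.dist_le_mul x 0
    have h2 : L * ‖x‖ ≤ L * (2 * δ) := mul_le_mul_of_nonneg_left hx L.coe_nonneg
    have h3 : s * ‖x‖ ≤ s * (2 * δ) := mul_le_mul_of_nonneg_left hx hspos.le
    have h4 : |h x| ≤ ψ x := le_trans (by linarith) (le_max_left _ _)
    obtain ⟨h5, h6⟩ := abs_le.1 h4
    simp only [he, hk]
    rw [min_eq_right h6, max_eq_right h5, sub_self]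
  have hefar : ∀ x y, x ≠ y → δ < ‖x‖ → δ < ‖y‖ → ‖e x - e y‖ ≤ 2 * ε * ω ‖x - y‖ := by
    intro x y hxy hx hy
    have h1 := abs_softThreshold_sub_le (a := h x) (b := h y) (hψ0 x) (hψ0 y)
    have h2 := hψω x y hxy
    have h3 : |h x - h y| ≤ ε * ω ‖x - y‖ := by
      simpa [hh] using hfar x y hxy hx hy
    simp only [he, hk, Real.norm_eq_abs]
    linarith
  have hemix : ∀ x y, x ≠ y → ‖x‖ ≤ 2 * δ → 2 * δ < ‖y‖ →
      ‖e x - e y‖ ≤ 2 * ε * ω ‖x - y‖ := by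
    intro x y hxy hx hy
    obtain ⟨w, hw, hwy⟩ := exists_norm_eq_of_le_of_le hx hy.le
    have hne : w ≠ y := by rintro rfl; linarith
    rw [hnear x hx, ← hnear w hw.le]
    refine (hefar w y hne (by linarith) (by linarith)).trans ?_
    exact mul_le_mul_of_nonneg_left (hmono _ _ (norm_pos_iff.2 (sub_ne_zero.2 hne)) hwy)
      (by positivity)
  refine ⟨k, ⟨_, hψ_lipschitz.neg.max (hψ_lipschitz.min hh_lipschitz)⟩, ⟨H / s, fun x hx => ?_⟩,
    fun x y hxy => ?_⟩
  · have h1 : ψ x = 0 := max_eq_right (by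
      have := (div_lt_iff₀' hspos).1 hx
      linarith)
    simp [hk, h1]
  · have heq : g x - k x - (g y - k y) = e x - e y := by simp only [he, hh]; ring
    rw [heq]
    rcases le_or_gt ‖x‖ (2 * δ) with hx | hx <;> rcases le_or_gt ‖y‖ (2 * δ) with hy | hy
    · rw [hnear x hx, hnear y hy, sub_self, norm_zero]
      have := hpos _ (norm_pos_iff.2 (sub_ne_zero.2 hxy))
      positivity
    · exact hemix x y hxy hx hy
    · rw [norm_sub_rev, norm_sub_rev x y]
      exact hemix y x hxy.symm hy hx
    · exact hefar x y hxy (by linarith) (by linarith)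

/-- Transfer of an oscillation bound across a Hölder approximation. -/
lemma HolderLE.norm_sub_le_add {ω : ℝ → ℝ} {f g : X → ℝ} {ε c : ℝ}
    (hfg : HolderLE ω (fun x => f x - g x) ε) {x y : X} (hxy : x ≠ y)
    (hg : ‖g x - g y‖ ≤ c * ω ‖x - y‖) : ‖f x - f y‖ ≤ (ε + c) * ω ‖x - y‖ := by
  have h1 := norm_add_le (f x - g x - (f y - g y)) (g x - g y)
  have h2 : f x - g x - (f y - g y) + (g x - g y) = f x - f y := by ring
  have h3 := hfg x y hxy
  rw [h2] at h1
  rw [add_mul]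
  linarith

lemma HolderLE.sub_symm {ω : ℝ → ℝ} {f g : X → ℝ} {ε : ℝ}
    (hfg : HolderLE ω (fun x => f x - g x) ε) : HolderLE ω (fun x => g x - f x) ε := by
  intro x y hxy
  have h : g x - f x - (g y - f y) = -(f x - g x - (f y - g y)) := by ring
  rw [h, norm_neg]
  exact hfg x y hxy

lemma HolderLE.trans_sub {ω : ℝ → ℝ} {f g k : X → ℝ} {ε c : ℝ}
    (hfg : HolderLE ω (fun x => f x - g x) ε) (hgk : HolderLE ω (fun x => g x - k x) c) :
    HolderLE ω (fun x => f x - k x) (ε + c) := by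
  intro x y hxy
  have h1 := norm_add_le (f x - g x - (f y - g y)) (g x - k x - (g y - k y))
  have h2 : f x - g x - (f y - g y) + (g x - k x - (g y - k y)) = f x - k x - (f y - k y) := by
    ring
  rw [h2] at h1
  rw [add_mul]
  exact h1.trans (add_le_add (hfg x y hxy) (hgk x y hxy))

/-- Limits of Lipschitz functions lie in the small-scale vanishing class. -/
lemma Admissible.vcsmall_of_approx [NormedSpace ℝ X] {ω : ℝ → ℝ} (hω : Admissible ω) {f : X → ℝ}
    (hf : HolderFinite ω f)
    (happ : ∀ ε : ℝ, 0 < ε → ∃ g : X → ℝ, (∃ L, LipschitzWith L g) ∧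
      HolderLE ω (fun x => f x - g x) ε) : VCsmall ω f := by
  refine ⟨hf, fun ε hε => ?_⟩
  obtain ⟨g, ⟨L, hL⟩, hfg⟩ := happ (ε / 2) (by positivity)
  obtain ⟨δ, hδ, h⟩ := hω.exists_le_mul (ε := ε / 2 / (L + 1)) (by positivity)
  refine ⟨δ, hδ, fun x y hxy hlt => ?_⟩
  have ht := norm_pos_iff.2 (sub_ne_zero.2 hxy)
  have h1 := h _ ht hlt
  have h2 : ‖g x - g y‖ ≤ ε / 2 * ω ‖x - y‖ := by
    have h3 := hL.dist_le_mul x y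
    rw [dist_eq_norm, dist_eq_norm] at h3
    have h4 : (0 : ℝ) < L + 1 := by positivity
    rw [div_mul_eq_mul_div, le_div_iff₀ h4] at h1
    linarith
  simpa using hfg.norm_sub_le_add hxy h2

lemma BddSupp.exists_bound {g : X → ℝ} {L : NNReal} (hL : LipschitzWith L g)
    (hg : BddSupp g) : ∃ B : ℝ, ∀ x, ‖g x‖ ≤ B := by
  obtain ⟨R, hR⟩ := hg
  refine ⟨‖g 0‖ + L * |R|, fun x => ?_⟩
  rcases le_or_gt ‖x‖ R with h | h
  · have h1 := hL.dist_le_mul x 0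
    rw [dist_eq_norm, dist_zero_right] at h1
    have h2 := norm_le_norm_add_norm_sub' (g x) (g 0)
    have h3 := mul_le_mul_of_nonneg_left (h.trans (le_abs_self R)) L.coe_nonneg
    linarith
  · rw [hR x h, norm_zero]
    positivity

end LipschitzApproximation

/-- Theorem 3.3 (Lipschitz approximation of `VC^{0,ω}`): (i) the closure in the `Ċ^{0,ω}`
seminorm of the Lipschitz members of `Ċ^{0,ω}(X,ℝ)` is `VC^{0,ω}_small(X,ℝ)`; (ii) the closure
of the boundedly supported Lipschitz functions is `VC^{0,ω}(X,ℝ)`. -/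
theorem closure_lipschitz_eq_vcsmall_and_vc
    {X : Type*} [NormedAddCommGroup X] [NormedSpace ℝ X]
    (ω : ℝ → ℝ) (hω : Admissible ω) (f : X → ℝ) :
    (VCsmall ω f ↔
      (HolderFinite ω f ∧ ∀ ε : ℝ, 0 < ε → ∃ g : X → ℝ,
        (∃ L, LipschitzWith L g) ∧ HolderFinite ω g ∧
        HolderLE ω (fun x => f x - g x) ε)) ∧
    (VCfull ω f ↔
      (HolderFinite ω f ∧ ∀ ε : ℝ, 0 < ε → ∃ g : X → ℝ,
        (∃ L, LipschitzWith L g) ∧ BddSupp g ∧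
        HolderLE ω (fun x => f x - g x) ε)) := by
  have hpos := hω.1
  have hmono := hω.2.1
  refine ⟨⟨fun hf => ⟨hf.1, fun ε hε => ?_⟩, fun hf => ?_⟩,
    ⟨fun hf => ⟨hf.1.1, fun ε hε => ?_⟩, fun hf => ⟨?_, ⟨hf.1, fun ε hε => ?_⟩,
      ⟨hf.1, fun ε hε => ?_⟩⟩⟩⟩
  · obtain ⟨δ, hδ, h⟩ := hf.2 (ε / 2) (by positivity)
    have := hf.1.exists_lipschitz_approx hpos hmono (by positivity) hδ h
    rwa [mul_div_cancel₀ ε two_ne_zero] at this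
  · exact hω.vcsmall_of_approx hf.1 fun ε hε =>
      let ⟨g, hg, _, hfg⟩ := hf.2 ε hε
      ⟨g, hg, hfg⟩
  · obtain ⟨hsmall, -, hfar⟩ := hf
    obtain ⟨δ, hδ, h⟩ := hsmall.2 (ε / 8) (by positivity)
    obtain ⟨g, ⟨L, hL⟩, -, hfg⟩ :=
      hsmall.1.exists_lipschitz_approx hpos hmono (by positivity) hδ h
    obtain ⟨ρ, hρ, h'⟩ := hfar.2 (ε / 8) (by positivity)
    obtain ⟨k, hk, hsupp, hgk⟩ :=
      hL.exists_bddSupp_approx hω (ε := 2 * (ε / 8) + ε / 8) (by positivity) hρ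
        fun x y hxy hx hy => hfg.sub_symm.norm_sub_le_add hxy (h' x y hxy hx hy)
    refine ⟨k, hk, hsupp, ?_⟩
    have hsum : 2 * (ε / 8) + 2 * (2 * (ε / 8) + ε / 8) = ε := by ring
    have := hfg.trans_sub hgk
    rwa [hsum] at this
  · exact hω.vcsmall_of_approx hf.1 fun ε hε =>
      let ⟨g, hg, _, hfg⟩ := hf.2 ε hε
      ⟨g, hg, hfg⟩
  · obtain ⟨g, ⟨L, hL⟩, hsupp, hfg⟩ := hf.2 (ε / 2) (by positivity)
    obtain ⟨B, hB⟩ := hsupp.exists_bound hL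
    obtain ⟨T, hT, hT0⟩ := ((hω.2.2.2.1.eventually_ge_atTop (2 * B / (ε / 2))).and
      (eventually_gt_atTop 0)).exists
    refine ⟨T, hT0, fun x y hxy => ?_⟩
    have hne : x ≠ y := by
      rintro rfl
      rw [sub_self, norm_zero] at hxy
      linarith
    have h1 : ‖g x - g y‖ ≤ ε / 2 * ω ‖x - y‖ := by
      have h2 := (div_le_iff₀' (by positivity)).1 (hT.trans (hmono _ _ hT0 hxy.le))
      linarith [norm_sub_le (g x) (g y), hB x, hB y]
    simpa using hfg.norm_sub_le_add hne h1
  · obtain ⟨g, -, ⟨R, hR⟩, hfg⟩ := hf.2 ε hε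
    refine ⟨|R| + 1, by positivity, fun x y hxy hx hy => ?_⟩
    have hR' := le_abs_self R
    have h1 : ‖g x - g y‖ ≤ 0 * ω ‖x - y‖ := by
      rw [hR x (by linarith), hR y (by linarith)]
      simp
    simpa using hfg.norm_sub_le_add hxy h1
end

section
/- Let k ∈ ℕ ∪ {∞} and let X be a normed space that admits a C^k and Lipschitz bump function. Let g : X → ℝ be Lipschitz with bounded support, and let (g_n) be a sequence of C^k Lipschitz functions on X converging to g uniformly on X with limsup_n Lip(g_n) < ∞. Then there exists a sequence (h_n) of C^k Lipschitz functions on X, each with bounded support, converging to g uniformly on X and with limsup_n Lip(h_n) < ∞. -/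
open Filter Set

/-- A space with a `C^k` Lipschitz bump has `C^k` Lipschitz cutoffs with values in `[-1, 1]`,
equal to `1` on a prescribed ball and of bounded support. -/
theorem exists_contDiff_lipschitz_cutoff
    {X : Type*} [NormedAddCommGroup X] [NormedSpace ℝ X] (k : ℕ∞)
    (hbump : ∃ φ : X → ℝ, φ ≠ 0 ∧ ContDiff ℝ k φ ∧ (∃ L, LipschitzWith L φ) ∧ BddSupp φ)
    (R : ℝ) :
    ∃ ψ : X → ℝ, ContDiff ℝ k ψ ∧ (∃ L, LipschitzWith L ψ) ∧ BddSupp ψ ∧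
      (∀ x, |ψ x| ≤ 1) ∧ ∀ x, ‖x‖ ≤ R → ψ x = 1 := by
  obtain ⟨φ, hφ, hφk, ⟨L, hL⟩, S, hS⟩ := hbump
  obtain ⟨x₀, hx₀⟩ := Function.ne_iff.1 hφ
  have hc : 0 < |φ x₀| := abs_pos.2 hx₀
  let θ : ContDiffBump (φ x₀) :=
    ⟨|φ x₀| / 4, |φ x₀| / 2, by positivity, by linarith⟩
  have hθk : ContDiff ℝ (k : WithTop ℕ∞) θ := θ.contDiff
  have hθ1 : ContDiff ℝ 1 θ := θ.contDiff
  obtain ⟨C, hC⟩ := hθ1.lipschitzWith_of_hasCompactSupport θ.hasCompactSupport one_ne_zero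
  have hθ0 : θ 0 = 0 := by
    apply θ.zero_of_le_dist
    rw [Real.dist_eq, zero_sub, abs_neg]
    change |φ x₀| / 2 ≤ |φ x₀|
    linarith
  set t : ℝ := |φ x₀| / (4 * (L + 1) * (|R| + 1)) with ht
  have htpos : 0 < t := by positivity
  have haff : LipschitzWith ‖t‖₊ fun x : X => x₀ + t • x := by
    refine LipschitzWith.of_dist_le_mul fun x y => ?_
    rw [dist_add_left, dist_smul₀, coe_nnnorm]
  refine ⟨fun x => θ (φ (x₀ + t • x)), ?_, ⟨_, hC.comp (hL.comp haff)⟩,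
    ⟨(S + ‖x₀‖) / t, fun x hx => ?_⟩, fun x => ?_, fun x hx => ?_⟩
  · exact hθk.comp (hφk.comp (contDiff_const.add (contDiff_const.smul contDiff_id)))
  · rw [div_lt_iff₀ htpos] at hx
    have h : ‖t • x‖ ≤ ‖x₀ + t • x‖ + ‖x₀‖ := by
      simpa using norm_sub_le (x₀ + t • x) x₀
    rw [norm_smul, Real.norm_of_nonneg htpos.le] at h
    change θ (φ (x₀ + t • x)) = 0
    have hz : φ (x₀ + t • x) = 0 := hS _ (by linarith)
    exact (congrArg θ hz).trans hθ0
  · rw [abs_of_nonneg θ.nonneg]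
    exact θ.le_one
  · apply θ.one_of_mem_closedBall
    rw [Metric.mem_closedBall]
    change dist _ _ ≤ |φ x₀| / 4
    have h := hL.dist_le_mul (x₀ + t • x) x₀
    rw [dist_self_add_left, norm_smul, Real.norm_of_nonneg htpos.le] at h
    refine h.trans ?_
    have hxR : ‖x‖ ≤ |R| + 1 := by linarith [le_abs_self R]
    calc (L : ℝ) * (t * ‖x‖) ≤ (L + 1) * (t * (|R| + 1)) := by gcongr; linarith
      _ = |φ x₀| / 4 := by rw [ht]; field_simp

/-- The product of a Lipschitz function with a Lipschitz cutoff is Lipschitz, with a constant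
depending on the function only through its Lipschitz constant and its size at the origin. -/
theorem LipschitzWith.cutoff_mul {X : Type*} [NormedAddCommGroup X]
    {ψ u : X → ℝ} {L K A R : NNReal} (hψ : LipschitzWith L ψ) (hψ1 : ∀ x, |ψ x| ≤ 1)
    (hψR : ∀ x, R < ‖x‖ → ψ x = 0) (hu : LipschitzWith K u) (hA : |u 0| ≤ A) :
    LipschitzWith (K + (A + K * R) * L) fun x => ψ x * u x := by
  have key : ∀ x y, ‖y‖ ≤ R →
      |ψ x * u x - ψ y * u y| ≤ (K + (A + K * R) * L) * dist x y := by
    intro x y hy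
    have huxy := hu.dist_le_mul x y
    have hψxy := hψ.dist_le_mul x y
    have huy := hu.dist_le_mul y 0
    rw [Real.dist_eq] at huxy hψxy huy
    rw [dist_zero_right] at huy
    have hBy : |u y| ≤ A + K * R := by
      have h1 := abs_sub_abs_le_abs_sub (u y) (u 0)
      have h2 : (K : ℝ) * ‖y‖ ≤ K * R := by gcongr
      linarith
    calc |ψ x * u x - ψ y * u y| = |ψ x * (u x - u y) + u y * (ψ x - ψ y)| := by ring_nf
      _ ≤ |ψ x| * |u x - u y| + |u y| * |ψ x - ψ y| := by
        simpa only [abs_mul] using abs_add_le (ψ x * (u x - u y)) (u y * (ψ x - ψ y))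
      _ ≤ 1 * (K * dist x y) + (A + K * R) * (L * dist x y) := by
        gcongr
        exact hψ1 x
      _ = (K + (A + K * R) * L) * dist x y := by ring
  refine LipschitzWith.of_dist_le_mul fun x y => ?_
  rw [Real.dist_eq]
  push_cast
  rcases le_or_gt ‖y‖ R with hy | hy
  · exact key x y hy
  rcases le_or_gt ‖x‖ R with hx | hx
  · rw [abs_sub_comm, dist_comm]
    exact key y x hx
  · rw [hψR x hx, hψR y hy]
    simp only [zero_mul, sub_zero, abs_zero]
    positivity

/-- Lemma 3.4: in a normed space with a `C^k` Lipschitz bump, a uniform approximation of a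
boundedly supported Lipschitz function by `C^k` Lipschitz functions with uniformly bounded
Lipschitz constants can be upgraded to one by boundedly supported `C^k` Lipschitz functions. -/
theorem smooth_lipschitz_bs_approx
    {X : Type*} [NormedAddCommGroup X] [NormedSpace ℝ X]
    (k : ℕ∞)
    (hbump : ∃ φ : X → ℝ, φ ≠ 0 ∧ ContDiff ℝ k φ ∧ (∃ L, LipschitzWith L φ) ∧ BddSupp φ)
    (g : X → ℝ) (hgLip : ∃ L, LipschitzWith L g) (hgbs : BddSupp g)
    (gseq : ℕ → X → ℝ)
    (hseq : ∀ m : ℕ, ContDiff ℝ k (gseq m) ∧ ∃ L, LipschitzWith L (gseq m))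
    (hunif : TendstoUniformly gseq g Filter.atTop)
    (hlimsup : ∃ L : NNReal, ∃ N : ℕ, ∀ m : ℕ, N ≤ m → LipschitzWith L (gseq m)) :
    ∃ hseq' : ℕ → X → ℝ,
      (∀ m : ℕ, ContDiff ℝ k (hseq' m) ∧ (∃ L, LipschitzWith L (hseq' m)) ∧
        BddSupp (hseq' m)) ∧
      TendstoUniformly hseq' g Filter.atTop ∧
      ∃ L : NNReal, ∃ N : ℕ, ∀ m : ℕ, N ≤ m → LipschitzWith L (hseq' m) := by
  obtain ⟨R, hR⟩ := hgbs
  obtain ⟨ψ, hψk, ⟨Lψ, hLψ⟩, ⟨S, hS⟩, hψ1, hψR⟩ := exists_contDiff_lipschitz_cutoff k hbump R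
  have hS' : ∀ x, (S.toNNReal : ℝ) < ‖x‖ → ψ x = 0 := fun x hx =>
    hS x ((Real.le_coe_toNNReal S).trans_lt hx)
  refine ⟨fun m x => ψ x * gseq m x, fun m => ⟨hψk.mul (hseq m).1, ?_, S, fun x hx => ?_⟩,
    ?_, ?_⟩
  · obtain ⟨K, hK⟩ := (hseq m).2
    exact ⟨_, hLψ.cutoff_mul (A := ‖gseq m 0‖₊) hψ1 hS' hK le_rfl⟩
  · change ψ x * gseq m x = 0
    rw [hS x hx, zero_mul]
  · rw [Metric.tendstoUniformly_iff] at hunif ⊢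
    intro ε hε
    filter_upwards [hunif ε hε] with m hm x
    have hg : g x = ψ x * g x := by
      rcases le_or_gt ‖x‖ R with hx | hx
      · rw [hψR x hx, one_mul]
      · rw [hR x hx, mul_zero]
    rw [hg, Real.dist_eq, ← mul_sub, abs_mul]
    exact (mul_le_of_le_one_left (abs_nonneg _) (hψ1 x)).trans_lt (hm x)
  · obtain ⟨K, N, hK⟩ := hlimsup
    obtain ⟨M, hM⟩ := eventually_atTop.1 (Metric.tendstoUniformly_iff.1 hunif 1 one_pos)
    refine ⟨_, max N M, fun m hm => hLψ.cutoff_mul (A := ‖g 0‖₊ + 1) hψ1 hS'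
      (hK m ((le_max_left _ _).trans hm)) ?_⟩
    have h := hM m ((le_max_right _ _).trans hm) 0
    rw [Real.dist_eq, abs_sub_comm] at h
    have h1 := abs_sub_abs_le_abs_sub (gseq m 0) (g 0)
    push_cast
    rw [Real.norm_eq_abs]
    linarith
end

section
/- Let α ∈ (0,1] and let X be a Banach space whose norm satisfies ‖x+h‖^{1+α} + ‖x−h‖^{1+α} − 2‖x‖^{1+α} ≤ C‖h‖^{1+α} for all x, h ∈ X, for some C > 0. Then there exists a constant κ ≥ 1, depending only on α and C, such that for every set S ⊆ X there exists a function h_S : X → [0,1] of class C^{1,α}(X) and Lipschitz, with: h_S(x) = 0 for every x ∈ S; h_S(x) = 1 whenever d(x,S) ≥ 1; Dh_S(x) = 0 for every x ∈ S ∪ {y ∈ X : d(y,S) ≥ 1}; and Lip(h_S) + ‖Dh_S‖_{Ċ^{0,α}(X,X*)} ≤ κ. -/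
open Set

open Filter Topology

section Zygmund

variable {X : Type*} [NormedAddCommGroup X] [NormedSpace ℝ X]

/-- Iterated bisection: the dyadic difference quotients of a function whose second differences
are `O(‖h‖ ^ (1 + α))` converge, with a quantitative error. -/
theorem exists_dyadic_limit {α A : ℝ} (hα : 0 < α) (hA : 0 ≤ A) {F : X → ℝ}
    (hF : ∀ x h : X, |F (x + h) + F (x - h) - 2 * F x| ≤ A * ‖h‖ ^ (1 + α)) (x h : X) :
    ∃ l : ℝ, Tendsto (fun n : ℕ => 2 ^ n * (F (x + (1 / 2 : ℝ) ^ n • h) - F x)) atTop (𝓝 l) ∧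
      |F (x + h) - F x - l| ≤ A / (1 - (1 / 2) ^ α) * ‖h‖ ^ (1 + α) := by
  set d : ℕ → ℝ := fun n => 2 ^ n * (F (x + (1 / 2 : ℝ) ^ n • h) - F x) with hd
  have hq : ((1 / 2 : ℝ) ^ α) < 1 := Real.rpow_lt_one (by norm_num) (by norm_num) hα
  have hstep : ∀ n, dist (d n) (d (n + 1)) ≤ A * ‖h‖ ^ (1 + α) * ((1 / 2 : ℝ) ^ α) ^ n := by
    intro n
    have key := hF (x + (1 / 2 : ℝ) ^ (n + 1) • h) ((1 / 2 : ℝ) ^ (n + 1) • h)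
    have e1 : x + (1 / 2 : ℝ) ^ (n + 1) • h + (1 / 2 : ℝ) ^ (n + 1) • h
        = x + (1 / 2 : ℝ) ^ n • h := by
      rw [add_assoc, ← add_smul]; congr 2; ring
    rw [e1, add_sub_cancel_right] at key
    have e2 : d n - d (n + 1) = 2 ^ n * (F (x + (1 / 2 : ℝ) ^ n • h) + F x
        - 2 * F (x + (1 / 2 : ℝ) ^ (n + 1) • h)) := by
      simp only [hd]; ring
    have hnorm : ‖(1 / 2 : ℝ) ^ (n + 1) • h‖ ≤ (1 / 2 : ℝ) ^ n * ‖h‖ := by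
      rw [norm_smul, Real.norm_of_nonneg (by positivity)]
      gcongr ?_ * _
      exact pow_le_pow_of_le_one (by norm_num) (by norm_num) (Nat.le_succ n)
    have hpow : ((1 / 2 : ℝ) ^ n * ‖h‖) ^ (1 + α)
        = (1 / 2 : ℝ) ^ n * ((1 / 2 : ℝ) ^ α) ^ n * ‖h‖ ^ (1 + α) := by
      rw [Real.mul_rpow (by positivity) (norm_nonneg _), Real.rpow_add (by positivity),
        Real.rpow_one, ← Real.rpow_natCast_mul (by norm_num), mul_comm (n : ℝ) α,
        Real.rpow_mul_natCast (by norm_num)]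
    have h2 : (2 : ℝ) ^ n * (1 / 2 : ℝ) ^ n = 1 := by
      rw [← mul_pow]; norm_num
    rw [Real.dist_eq, e2, abs_mul, abs_of_nonneg (by positivity)]
    calc _ ≤ (2 : ℝ) ^ n * (A * ((1 / 2 : ℝ) ^ n * ‖h‖) ^ (1 + α)) := by
          gcongr
          exact key.trans (by gcongr)
      _ = (2 ^ n * (1 / 2 : ℝ) ^ n) * (A * ‖h‖ ^ (1 + α) * ((1 / 2 : ℝ) ^ α) ^ n) := by
          rw [hpow]; ring
      _ = _ := by rw [h2, one_mul]
  obtain ⟨l, hl⟩ := cauchySeq_tendsto_of_complete (cauchySeq_of_le_geometric _ _ hq hstep)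
  refine ⟨l, hl, ?_⟩
  have := dist_le_of_le_geometric_of_tendsto₀ _ _ hq hstep hl
  rw [Real.dist_eq] at this
  simp only [hd, pow_zero, one_mul, one_smul] at this
  exact this.trans_eq (by ring)

/-- A bounded function whose second differences are `O(‖h‖ ^ (1 + α))` has a first-order Taylor
expansion with remainder `O(‖h‖ ^ (1 + α))` at every point. -/
theorem exists_clm_taylor_bound {α A : ℝ} (hα : 0 < α) (hA : 0 ≤ A) {F : X → ℝ}
    (hF : ∀ x h : X, |F (x + h) + F (x - h) - 2 * F x| ≤ A * ‖h‖ ^ (1 + α))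
    (hF01 : ∀ x, F x ∈ Icc (0 : ℝ) 1) (x : X) :
    ∃ L : X →L[ℝ] ℝ, ∀ h,
      |F (x + h) - F x - L h| ≤ A / (1 - (1 / 2) ^ α) * ‖h‖ ^ (1 + α) := by
  choose l hl hlb using exists_dyadic_limit hα hA hF x
  set B := A / (1 - (1 / 2 : ℝ) ^ α) with hB
  have hB0 : 0 ≤ B := div_nonneg hA
    (sub_nonneg.2 (Real.rpow_lt_one (by norm_num) (by norm_num) hα).le)
  have hdouble : ∀ h, l ((2 : ℝ) • h) = 2 * l h := by
    intro h
    refine tendsto_nhds_unique ((tendsto_add_atTop_iff_nat 1).2 (hl ((2 : ℝ) • h)))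
      (((hl h).const_mul 2).congr fun n => ?_)
    rw [smul_smul, show (1 / 2 : ℝ) ^ (n + 1) * 2 = (1 / 2) ^ n by ring]
    ring
  have hmid : ∀ h k, l (h + k + (h - k)) + l (h + k - (h - k)) = 2 * l (h + k) := by
    intro h k
    have ht := ((hl (h + k + (h - k))).add (hl (h + k - (h - k)))).sub ((hl (h + k)).const_mul 2)
    have h0 : Tendsto (fun n : ℕ => A * ‖h - k‖ ^ (1 + α) * ((1 / 2 : ℝ) ^ α) ^ n) atTop (𝓝 0) := by
      simpa using (tendsto_pow_atTop_nhds_zero_of_lt_one (by positivity)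
        (Real.rpow_lt_one (by norm_num) (by norm_num) hα)).const_mul (A * ‖h - k‖ ^ (1 + α))
    have := tendsto_nhds_unique ht (squeeze_zero_norm (fun n => ?_) h0)
    · linarith
    have key := hF (x + (1 / 2 : ℝ) ^ n • (h + k)) ((1 / 2 : ℝ) ^ n • (h - k))
    rw [add_assoc, ← smul_add, add_sub_assoc x, ← smul_sub, norm_smul,
      Real.norm_of_nonneg (by positivity), Real.mul_rpow (by positivity) (norm_nonneg _),
      Real.rpow_add (by positivity), Real.rpow_one, ← Real.rpow_natCast_mul (by norm_num),
      mul_comm (n : ℝ) α, Real.rpow_mul_natCast (by norm_num)] at key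
    have h2 : (2 : ℝ) ^ n * (1 / 2 : ℝ) ^ n = 1 := by
      rw [← mul_pow]; norm_num
    have := mul_le_mul_of_nonneg_left key (show (0 : ℝ) ≤ 2 ^ n by positivity)
    rw [← abs_of_nonneg (show (0 : ℝ) ≤ 2 ^ n by positivity), ← abs_mul,
      abs_of_nonneg (show (0 : ℝ) ≤ 2 ^ n by positivity)] at this
    rw [Real.norm_eq_abs]
    refine (le_of_eq ?_).trans (this.trans (le_of_eq ?_))
    · congr 1; ring
    · linear_combination (A * ‖h - k‖ ^ (1 + α) * ((1 / 2 : ℝ) ^ α) ^ n) * h2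
  have hadd : ∀ h k, l (h + k) = l h + l k := by
    intro h k
    have := hmid h k
    rw [show h + k + (h - k) = (2 : ℝ) • h by rw [two_smul]; abel,
      show h + k - (h - k) = (2 : ℝ) • k by rw [two_smul]; abel, hdouble, hdouble] at this
    linarith
  let f : X →+ ℝ := AddMonoidHom.mk' l hadd
  have hfc : Continuous f := by
    refine f.continuous_of_isBounded_nhds_zero (Metric.ball_mem_nhds (0 : X) one_pos) ?_
    refine (Metric.isBounded_closedBall (x := (0 : ℝ)) (r := 1 + B)).subset ?_
    rintro _ ⟨h, hh, rfl⟩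
    rw [mem_ball_zero_iff] at hh
    rw [mem_closedBall_zero_iff, Real.norm_eq_abs]
    have h1 : B * ‖h‖ ^ (1 + α) ≤ B :=
      mul_le_of_le_one_right hB0 (Real.rpow_le_one (norm_nonneg _) hh.le (by linarith))
    have h2 := abs_le.1 ((hlb h).trans h1)
    have h3 := hF01 (x + h)
    have h4 := hF01 x
    change |l h| ≤ _
    rw [abs_le]
    constructor <;> linarith [h3.1, h3.2, h4.1, h4.2, h2.1, h2.2]
  exact ⟨f.toRealLinearMap hfc, hlb⟩

/-- A first-order Taylor expansion with uniform remainder `B * ‖h‖ ^ (1 + α)` makes the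
derivative `α`-Hölder. -/
theorem norm_sub_le_of_taylor_bound {α B : ℝ} (hα : α ∈ Ioc (0 : ℝ) 1) (hB : 0 ≤ B) {F : X → ℝ}
    {L : X → X →L[ℝ] ℝ}
    (hL : ∀ x h, |F (x + h) - F x - L x h| ≤ B * ‖h‖ ^ (1 + α)) (x y : X) :
    ‖L x - L y‖ ≤ 6 * B * ‖x - y‖ ^ α := by
  obtain ⟨hα0, hα1⟩ := hα
  rcases eq_or_ne x y with rfl | hxy
  · simp [Real.zero_rpow hα0.ne']
  set r := ‖x - y‖ with hr
  have hr0 : 0 < r := norm_pos_iff.2 (sub_ne_zero.2 hxy)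
  refine ContinuousLinearMap.opNorm_le_of_unit_norm (by positivity) fun u hu => ?_
  have hru : ‖r • u‖ = r := by rw [norm_smul, hu, mul_one, Real.norm_of_nonneg hr0.le]
  have h1 := hL y (r • u)
  have h2 := hL x (y - x)
  have h3 := hL x (y - x + r • u)
  rw [hru] at h1
  rw [norm_sub_rev, ← hr, add_sub_cancel] at h2
  rw [← add_assoc, add_sub_cancel, map_add] at h3
  have h4 : ‖y - x + r • u‖ ^ (1 + α) ≤ 4 * r ^ (1 + α) := by
    calc _ ≤ (2 * r) ^ (1 + α) := by
          gcongr
          refine (norm_add_le _ _).trans ?_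
          rw [hru, norm_sub_rev, ← hr]; linarith
      _ = 2 ^ (1 + α) * r ^ (1 + α) := Real.mul_rpow (by norm_num) hr0.le
      _ ≤ 2 ^ (2 : ℝ) * r ^ (1 + α) := by gcongr <;> linarith
      _ = _ := by norm_num
  have h3' := h3.trans (mul_le_mul_of_nonneg_left h4 hB)
  have hp : r ^ (1 + α) = r * r ^ α := by rw [Real.rpow_add hr0, Real.rpow_one]
  have h5 : |(L x - L y) (r • u)| ≤ r * (6 * B * r ^ α) := by
    rw [hp] at h1 h2 h3'
    rw [sub_apply]
    rw [abs_le] at *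
    constructor <;> linarith [h1.1, h1.2, h2.1, h2.2, h3'.1, h3'.2]
  rw [map_smul, smul_eq_mul, abs_mul, abs_of_pos hr0] at h5
  exact le_of_mul_le_mul_left h5 hr0

/-- A `[0,1]`-valued function with second differences bounded by `A * ‖h‖ ^ (1 + α)` is
Lipschitz and `C^{1,α}`, with constants depending only on `α` and `A`. -/
theorem differentiable_and_bounds_of_second_difference {α A : ℝ} (hα : α ∈ Ioc (0 : ℝ) 1)
    (hA : 0 ≤ A) {F : X → ℝ}
    (hF : ∀ x h : X, |F (x + h) + F (x - h) - 2 * F x| ≤ A * ‖h‖ ^ (1 + α))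
    (hF01 : ∀ x, F x ∈ Icc (0 : ℝ) 1) :
    Differentiable ℝ F ∧
      (∀ x y, |F x - F y| ≤ (1 + A / (1 - (1 / 2) ^ α)) * ‖x - y‖) ∧
      ∀ x y, ‖fderiv ℝ F x - fderiv ℝ F y‖ ≤ 6 * (A / (1 - (1 / 2) ^ α)) * ‖x - y‖ ^ α := by
  choose L hL using exists_clm_taylor_bound hα.1 hA hF hF01
  set B := A / (1 - (1 / 2 : ℝ) ^ α) with hBdef
  have hB : 0 ≤ B := div_nonneg hA
    (sub_nonneg.2 (Real.rpow_lt_one (by norm_num) (by norm_num) hα.1).le)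
  have hderiv : ∀ x, HasFDerivAt F (L x) x := by
    intro x
    rw [hasFDerivAt_iff_isLittleO_nhds_zero]
    have hO : (fun h : X => F (x + h) - F x - L x h) =O[𝓝 0] fun h => ‖h‖ ^ (1 + α) :=
      Asymptotics.IsBigO.of_bound B (Eventually.of_forall fun h => by
        rw [Real.norm_eq_abs, Real.norm_of_nonneg (by positivity)]
        exact hL x h)
    refine hO.trans_isLittleO ?_
    have h0 : Tendsto (fun h : X => ‖h‖ ^ α) (𝓝 0) (𝓝 0) := by
      have : Continuous fun h : X => ‖h‖ ^ α :=
        continuous_norm.rpow_const fun _ => Or.inr hα.1.le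
      simpa [Real.zero_rpow hα.1.ne'] using this.tendsto 0
    have h1 := ((Asymptotics.isLittleO_one_iff ℝ).2 h0).mul_isBigO
      (Asymptotics.isBigO_refl (fun h : X => ‖h‖) (𝓝 0))
    simp only [one_mul] at h1
    refine (h1.congr_left fun h => ?_).of_norm_right
    rw [← Real.rpow_add_one' (norm_nonneg _) (by linarith [hα.1]), add_comm]
  have hfd : ∀ x, fderiv ℝ F x = L x := fun x => (hderiv x).fderiv
  refine ⟨fun x => (hderiv x).differentiableAt, fun x y => ?_, fun x y => ?_⟩
  · refine convex_univ.norm_image_sub_le_of_norm_hasFDerivWithin_le (𝕜 := ℝ)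
      (fun z _ => (hderiv z).hasFDerivWithinAt) (fun z _ => ?_) (mem_univ y) (mem_univ x)
    refine ContinuousLinearMap.opNorm_le_of_unit_norm (by positivity) fun u hu => ?_
    have h1 := hL z u
    have h2 := hF01 (z + u)
    have h3 := hF01 z
    rw [hu, Real.one_rpow, mul_one] at h1
    rw [Real.norm_eq_abs]
    rw [abs_le] at *
    constructor <;> linarith [h1.1, h1.2, h2.1, h2.2, h3.1, h3.2]
  · rw [hfd, hfd]
    exact norm_sub_le_of_taylor_bound hα hB hL x y

/-- Insertion: if `g` has second differences bounded above by `ω h` and `f ≤ g` has second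
differences bounded below by `-ω h`, some function between them has second differences bounded
in absolute value by `ω h`. It is the largest minorant of `g` with the same lower bound as `f`. -/
theorem exists_between_second_difference {E : Type*} [AddCommGroup E] {ω : E → ℝ} {f g : E → ℝ}
    (hf : ∀ x h, -ω h ≤ f (x + h) + f (x - h) - 2 * f x)
    (hg : ∀ x h, g (x + h) + g (x - h) - 2 * g x ≤ ω h) (hfg : ∀ x, f x ≤ g x) :
    ∃ F : E → ℝ, (∀ x, f x ≤ F x) ∧ (∀ x, F x ≤ g x) ∧
      ∀ x h, |F (x + h) + F (x - h) - 2 * F x| ≤ ω h := by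
  let U : Set (E → ℝ) :=
    {u | (∀ x h, -ω h ≤ u (x + h) + u (x - h) - 2 * u x) ∧ ∀ x, u x ≤ g x}
  let F : E → ℝ := fun x => sSup ((fun u : E → ℝ => u x) '' U)
  have hfU : f ∈ U := ⟨hf, hfg⟩
  have hle : ∀ u ∈ U, ∀ x, u x ≤ F x := fun u hu x =>
    le_csSup ⟨g x, by rintro _ ⟨v, hv, rfl⟩; exact hv.2 x⟩ ⟨u, hu, rfl⟩
  have hFle : ∀ x c, (∀ u ∈ U, u x ≤ c) → F x ≤ c := fun x c hc =>
    csSup_le ⟨f x, f, hfU, rfl⟩ (by rintro _ ⟨v, hv, rfl⟩; exact hc v hv)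
  have hFg : ∀ x, F x ≤ g x := fun x => hFle x _ fun u hu => hu.2 x
  have hlow : ∀ x h, -ω h ≤ F (x + h) + F (x - h) - 2 * F x := by
    intro x h
    have := hFle x ((F (x + h) + F (x - h) + ω h) / 2) fun u hu => by
      linarith [hu.1 x h, hle u hu (x + h), hle u hu (x - h)]
    linarith
  refine ⟨F, hle f hfU, hFg, fun x h => abs_le.2 ⟨hlow x h, ?_⟩⟩
  have hv : (fun y => (F (y + h) + F (y - h) - ω h) / 2) ∈ U := by
    refine ⟨fun y k => ?_, fun y => ?_⟩
    · have h1 := hlow (y + h) k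
      have h2 := hlow (y - h) k
      rw [add_right_comm y h k, add_sub_right_comm y h k] at h1
      rw [sub_add_eq_add_sub y h k, sub_right_comm y h k] at h2
      change -ω k ≤ (F (y + k + h) + F (y + k - h) - ω h) / 2
        + (F (y - k + h) + F (y - k - h) - ω h) / 2 - 2 * ((F (y + h) + F (y - h) - ω h) / 2)
      linarith
    · linarith [hg y h, hFg (y + h), hFg (y - h)]
  linarith [hle _ hv x]

end Zygmund

/-- Truncated powers of the distance to a set inherit the upper second-difference estimate of
the corresponding power of the norm. -/
theorem min_one_infDist_rpow_second_difference_le {X : Type*} [NormedAddCommGroup X]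
    {p C : ℝ} (hp : 0 < p) (hC : 0 ≤ C)
    (hX : ∀ x h : X, ‖x + h‖ ^ p + ‖x - h‖ ^ p - 2 * ‖x‖ ^ p ≤ C * ‖h‖ ^ p)
    {S : Set X} (hS : S.Nonempty) (x h : X) :
    min 1 ((2 * Metric.infDist (x + h) S) ^ p) + min 1 ((2 * Metric.infDist (x - h) S) ^ p)
      - 2 * min 1 ((2 * Metric.infDist x S) ^ p) ≤ 2 ^ p * C * ‖h‖ ^ p := by
  have hd : ∀ y, 0 ≤ Metric.infDist y S := fun y => Metric.infDist_nonneg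
  have hnn : 0 ≤ C * ‖h‖ ^ p := by positivity
  have key : Metric.infDist (x + h) S ^ p + Metric.infDist (x - h) S ^ p - C * ‖h‖ ^ p
      ≤ 2 * Metric.infDist x S ^ p := by
    set c := (Metric.infDist (x + h) S ^ p + Metric.infDist (x - h) S ^ p - C * ‖h‖ ^ p) / 2
      with hc
    suffices c ≤ Metric.infDist x S ^ p by linarith
    rcases le_or_gt c 0 with h0 | h0
    · exact h0.trans (Real.rpow_nonneg (hd x) p)
    rw [← Real.rpow_inv_le_iff_of_pos h0.le (hd x) hp, Metric.le_infDist hS]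
    intro s hs
    rw [Real.rpow_inv_le_iff_of_pos h0.le dist_nonneg hp]
    have h1 : Metric.infDist (x + h) S ^ p ≤ ‖x - s + h‖ ^ p :=
      Real.rpow_le_rpow (hd _) ((Metric.infDist_le_dist_of_mem hs).trans_eq
        (by rw [dist_eq_norm]; congr 1; abel)) hp.le
    have h2 : Metric.infDist (x - h) S ^ p ≤ ‖x - s - h‖ ^ p :=
      Real.rpow_le_rpow (hd _) ((Metric.infDist_le_dist_of_mem hs).trans_eq
        (by rw [dist_eq_norm]; congr 1; abel)) hp.le
    rw [dist_eq_norm]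
    linarith [hX (x - s) h]
  have h2p : (0 : ℝ) ≤ 2 ^ p := by positivity
  have key2 := mul_le_mul_of_nonneg_left key h2p
  have hm := mul_nonneg h2p hnn
  simp only [Real.mul_rpow zero_le_two (hd _)]
  rcases min_cases 1 ((2 : ℝ) ^ p * Metric.infDist x S ^ p) with ⟨e, _⟩ | ⟨e, _⟩ <;> rw [e]
  · linarith [min_le_left 1 ((2 : ℝ) ^ p * Metric.infDist (x + h) S ^ p),
      min_le_left 1 ((2 : ℝ) ^ p * Metric.infDist (x - h) S ^ p)]
  · linarith [min_le_right 1 ((2 : ℝ) ^ p * Metric.infDist (x + h) S ^ p),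
      min_le_right 1 ((2 : ℝ) ^ p * Metric.infDist (x - h) S ^ p)]


/-- Theorem 3.8 (1): in a Banach space whose norm has modulus of smoothness of power type
`1+α`, there is a constant `κ ≥ 1`, depending only on `α` and `C`, such that for every set
`S ⊆ X` there is a `C^{1,α}` Lipschitz transition function `h_S : X → [0,1]` vanishing on `S`,
equal to `1` at distance `≥ 1` from `S`, with vanishing derivative on both regions, and with
`Lip(h_S) + ‖Dh_S‖_{Ċ^{0,α}} ≤ κ`. -/
theorem exists_C1alpha_separating_bump (α C : ℝ) (hα : α ∈ Ioc (0:ℝ) 1) (hC : 0 < C) :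
    ∃ κ : ℝ, 1 ≤ κ ∧
      ∀ (X : Type) [NormedAddCommGroup X] [NormedSpace ℝ X] [CompleteSpace X],
        (∀ x h : X,
          ‖x + h‖ ^ (1 + α) + ‖x - h‖ ^ (1 + α) - 2 * ‖x‖ ^ (1 + α) ≤ C * ‖h‖ ^ (1 + α)) →
        ∀ S : Set X, ∃ hS : X → ℝ,
          (∀ x : X, hS x ∈ Icc (0:ℝ) 1) ∧
          Differentiable ℝ hS ∧
          (∀ x ∈ S, hS x = 0) ∧
          (∀ x : X, 1 ≤ Metric.infDist x S → hS x = 1) ∧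
          (∀ x : X, x ∈ S ∪ {y : X | 1 ≤ Metric.infDist y S} → fderiv ℝ hS x = 0) ∧
          (∃ L K : ℝ, 0 ≤ L ∧ 0 ≤ K ∧
            (∀ x y : X, |hS x - hS y| ≤ L * ‖x - y‖) ∧
            (∀ x y : X, ‖fderiv ℝ hS x - fderiv ℝ hS y‖ ≤ K * ‖x - y‖ ^ α) ∧
            L + K ≤ κ) := by
  have hq : ((1 / 2 : ℝ) ^ α) < 1 := Real.rpow_lt_one (by norm_num) (by norm_num) hα.1
  set A := 2 ^ (1 + α) * C with hAdef
  have hA : 0 ≤ A := by positivity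
  set B := A / (1 - (1 / 2 : ℝ) ^ α) with hBdef
  have hB : 0 ≤ B := div_nonneg hA (sub_nonneg.2 hq.le)
  have hp : 0 < 1 + α := by linarith [hα.1]
  refine ⟨1 + B + 6 * B, by linarith, ?_⟩
  intro X _ _ _ hX S
  set T : Set X := {y : X | 1 ≤ Metric.infDist y S} with hT
  rcases T.eq_empty_or_nonempty with hTe | hTn
  · refine ⟨fun _ => 0, fun _ => by simp, differentiable_const _, fun _ _ => rfl, fun x hx => ?_,
      fun x _ => by simp, 0, 0, le_rfl, le_rfl, fun x y => by simp, fun x y => by simp,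
      by linarith⟩
    exact absurd (show x ∈ T from hx) (by simp [hTe])
  have hSn : S.Nonempty := by
    rw [nonempty_iff_ne_empty]
    rintro rfl
    obtain ⟨y, hy⟩ := hTn
    norm_num [hT] at hy
  have hone : ∀ (V : Set X) (x : X), 1 / 2 ≤ Metric.infDist x V →
      min 1 ((2 * Metric.infDist x V) ^ (1 + α)) = 1 := fun V x hx =>
    min_eq_left (Real.one_le_rpow (by linarith) hp.le)
  have hzero : ∀ (V : Set X), ∀ x ∈ V, min 1 ((2 * Metric.infDist x V) ^ (1 + α)) = 0 := by
    intro V x hx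
    rw [Metric.infDist_zero_of_mem hx, mul_zero, Real.zero_rpow hp.ne']
    simp
  have hnonneg : ∀ (V : Set X) (x : X), 0 ≤ min 1 ((2 * Metric.infDist x V) ^ (1 + α)) :=
    fun V x => le_min zero_le_one
      (Real.rpow_nonneg (mul_nonneg zero_le_two Metric.infDist_nonneg) _)
  obtain ⟨F, hfF, hFg, hF⟩ := exists_between_second_difference
    (ω := fun h : X => A * ‖h‖ ^ (1 + α))
    (f := fun x => 1 - min 1 ((2 * Metric.infDist x T) ^ (1 + α)))
    (g := fun x => min 1 ((2 * Metric.infDist x S) ^ (1 + α)))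
    (fun x h => by
      linarith [min_one_infDist_rpow_second_difference_le hp hC.le hX hTn x h])
    (fun x h => min_one_infDist_rpow_second_difference_le hp hC.le hX hSn x h)
    (fun x => by
      rcases le_or_gt (1 / 2) (Metric.infDist x S) with h | h
      · rw [hone S x h]
        linarith [hnonneg T x]
      · rw [hone T x ?_, sub_self]
        · exact hnonneg S x
        rw [Metric.le_infDist hTn]
        intro y hy
        have h1 : 1 ≤ Metric.infDist y S := hy
        have h2 := Metric.infDist_le_infDist_add_dist (s := S) (x := y) (y := x)
        rw [dist_comm] at h2
        linarith)
  have hF01 : ∀ x, F x ∈ Icc (0 : ℝ) 1 := fun x =>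
    ⟨le_trans (sub_nonneg.2 (min_le_left _ _)) (hfF x), (hFg x).trans (min_le_left _ _)⟩
  have hFS : ∀ x ∈ S, F x = 0 := fun x hx =>
    le_antisymm ((hFg x).trans_eq (hzero S x hx)) (hF01 x).1
  have hFT : ∀ x ∈ T, F x = 1 := fun x hx =>
    le_antisymm (hF01 x).2 (le_trans (by rw [hzero T x hx, sub_zero]) (hfF x))
  obtain ⟨hdiff, hlip, hhol⟩ := differentiable_and_bounds_of_second_difference hα hA hF hF01
  refine ⟨F, hF01, hdiff, hFS, hFT, ?_, 1 + B, 6 * B, by linarith, by linarith, hlip, hhol,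
    le_rfl⟩
  rintro x (hx | hx)
  · refine IsLocalMin.fderiv_eq_zero (Eventually.of_forall fun y => ?_)
    rw [hFS x hx]
    exact (hF01 y).1
  · refine IsLocalMax.fderiv_eq_zero (Eventually.of_forall fun y => ?_)
    rw [hFT x hx]
    exact (hF01 y).2
end

section
/- Let α ∈ (0,1] and let X be a Banach space whose norm satisfies ‖x+h‖^{1+α} + ‖x−h‖^{1+α} − 2‖x‖^{1+α} ≤ C‖h‖^{1+α} for all x, h ∈ X, for some C > 0. Then there exists a constant κ ≥ 1, depending only on α and C, such that for every L-Lipschitz function g : X → ℝ and every ε > 0, there exists h : X → ℝ of class C^{1,α}(X) such that h is κL-Lipschitz and sup_{x∈X} |g(x) − h(x)| ≤ ε. -/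
open Set Filter Topology

/-- A pair `u ≤ v`, with `u` semiconvex and `v` semiconcave with the same modulus, can be separated
by a function which is both; the separating function inherits the Lipschitz bound of `v`. -/
lemma exists_between_of_semiconvex_semiconcave {X : Type*} [NormedAddCommGroup X]
    {ω : X → ℝ} {u v : X → ℝ} {L : ℝ} (huv : ∀ x, u x ≤ v x)
    (hu : ∀ x h, 2 * u x ≤ u (x + h) + u (x - h) + ω h)
    (hv : ∀ x h, v (x + h) + v (x - h) ≤ 2 * v x + ω h)
    (hL : ∀ x y, v x ≤ v y + L * ‖x - y‖) :
    ∃ f : X → ℝ, (∀ x, u x ≤ f x) ∧ (∀ x, f x ≤ v x) ∧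
      (∀ x h, |f (x + h) + f (x - h) - 2 * f x| ≤ ω h) ∧
      ∀ x y, f x ≤ f y + L * ‖x - y‖ := by
  let K : Set (X → ℝ) :=
    {w | (∀ x, w x ≤ v x) ∧ ∀ x h, 2 * w x ≤ w (x + h) + w (x - h) + ω h}
  have huK : u ∈ K := ⟨huv, hu⟩
  have : Nonempty K := ⟨⟨u, huK⟩⟩
  let f : X → ℝ := fun x => ⨆ w : K, w.1 x
  have le_f : ∀ w ∈ K, ∀ x, w x ≤ f x := fun w hw x =>
    le_ciSup (f := fun w : K => w.1 x) ⟨v x, by rintro _ ⟨w, rfl⟩; exact w.2.1 x⟩ ⟨w, hw⟩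
  have f_le : ∀ x, f x ≤ v x := fun x => ciSup_le fun w => w.2.1 x
  have f_conv : ∀ x h, 2 * f x ≤ f (x + h) + f (x - h) + ω h := by
    intro x h
    have : f x ≤ (f (x + h) + f (x - h) + ω h) / 2 := ciSup_le fun w => by
      have h1 := w.2.2 x h
      have h2 := le_f _ w.2 (x + h)
      have h3 := le_f _ w.2 (x - h)
      linarith
    linarith
  refine ⟨f, le_f u huK, f_le, fun x h => ?_, fun x y => ?_⟩
  · have hw : (fun z => (f (z + h) + f (z - h) - ω h) / 2) ∈ K := by
      refine ⟨fun z => ?_, fun z k => ?_⟩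
      · have h1 := f_le (z + h)
        have h2 := f_le (z - h)
        have h3 := hv z h
        linarith
      · have h1 := f_conv (z + h) k
        have h2 := f_conv (z - h) k
        rw [add_right_comm z h k, add_sub_right_comm z h k] at h1
        rw [← add_sub_right_comm z k h, sub_right_comm z h k] at h2
        linarith
    have h1 := le_f _ hw x
    have h2 := f_conv x h
    rw [abs_le]
    constructor <;> linarith
  · have hw : (fun z => f (z + (x - y)) - L * ‖x - y‖) ∈ K := by
      refine ⟨fun z => ?_, fun z k => ?_⟩
      · have h1 := f_le (z + (x - y))
        have h2 := hL (z + (x - y)) z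
        rw [add_sub_cancel_left] at h2
        linarith
      · have h1 := f_conv (z + (x - y)) k
        rw [add_right_comm z, add_sub_right_comm z] at h1
        linarith
    have h1 := le_f _ hw y
    simp only [add_sub_cancel] at h1
    linarith

/-- Properties of the inf-convolution of a Lipschitz function with `t ‖·‖ ^ p`. -/
lemma exists_semiconcave_approx {X : Type*} [NormedAddCommGroup X] {p C L t δ : ℝ} (ht : 0 ≤ t)
    (hX : ∀ x h : X, ‖x + h‖ ^ p + ‖x - h‖ ^ p - 2 * ‖x‖ ^ p ≤ C * ‖h‖ ^ p)
    (hp : p ≠ 0) {g : X → ℝ} (hg : ∀ x y, g x ≤ g y + L * ‖x - y‖)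
    (hδ : ∀ r : ℝ, 0 ≤ r → L * r ≤ t * r ^ p + δ) :
    ∃ v : X → ℝ, (∀ x, g x - δ ≤ v x) ∧ (∀ x, v x ≤ g x) ∧
      (∀ x h, v (x + h) + v (x - h) ≤ 2 * v x + t * C * ‖h‖ ^ p) ∧
      ∀ x y, v x ≤ v y + L * ‖x - y‖ := by
  let v : X → ℝ := fun x => ⨅ y, (g y + t * ‖x - y‖ ^ p)
  have hlow : ∀ x y, g x - δ ≤ g y + t * ‖x - y‖ ^ p := fun x y => by
    have h1 := hg x y
    have h2 := hδ ‖x - y‖ (norm_nonneg _)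
    linarith
  have v_le : ∀ x y, v x ≤ g y + t * ‖x - y‖ ^ p := fun x y =>
    ciInf_le ⟨g x - δ, by rintro _ ⟨y, rfl⟩; exact hlow x y⟩ y
  refine ⟨v, fun x => le_ciInf (hlow x), fun x => ?_, fun x h => ?_, fun x y => ?_⟩
  · simpa [Real.zero_rpow hp] using v_le x x
  · have : (v (x + h) + v (x - h) - t * C * ‖h‖ ^ p) / 2 ≤ v x := le_ciInf fun y => by
      have h1 := v_le (x + h) y
      have h2 := v_le (x - h) y
      have h3 := mul_le_mul_of_nonneg_left (hX (x - y) h) ht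
      rw [add_sub_right_comm] at h1
      rw [sub_right_comm] at h2
      linarith
    linarith
  · have : v x - L * ‖x - y‖ ≤ v y := le_ciInf fun z => by
      have h1 := v_le x (z + (x - y))
      have h2 := hg (z + (x - y)) z
      rw [add_sub_cancel_left] at h2
      rw [show x - (z + (x - y)) = y - z by abel] at h1
      linarith
    linarith

/-- A Lipschitz function whose symmetric second differences are `O(‖h‖ ^ (1 + α))` has at each
point a linear approximation with error `O(‖h‖ ^ (1 + α))`. -/
lemma exists_clm_approx_of_second_difference {X : Type*} [NormedAddCommGroup X] [NormedSpace ℝ X]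
    {α A L : ℝ} (hα : 0 < α) (hA : 0 ≤ A) {f : X → ℝ}
    (hf : ∀ x h, |f (x + h) + f (x - h) - 2 * f x| ≤ A * ‖h‖ ^ (1 + α))
    (hL : ∀ x y, |f x - f y| ≤ L * ‖x - y‖) (x : X) :
    ∃ D : X →L[ℝ] ℝ, ∀ h,
      |f (x + h) - f x - D h| ≤ A / (1 - (1 / 2 : ℝ) ^ α) * ‖h‖ ^ (1 + α) := by
  set r : ℝ := (1 / 2 : ℝ) ^ α with hr
  have hr0 : 0 < r := by positivity
  have hr1 : r < 1 := Real.rpow_lt_one (by norm_num) (by norm_num) hα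
  let q : X → ℕ → ℝ := fun h n => 2 ^ n * (f (x + (1 / 2 : ℝ) ^ n • h) - f x)
  have hq : ∀ h k n, |q h n + q k n - q (h + k) (n + 1)| ≤ A * ‖h - k‖ ^ (1 + α) * r ^ n := by
    intro h k n
    have h1 := hf (x + (1 / 2 : ℝ) ^ (n + 1) • (h + k)) ((1 / 2 : ℝ) ^ (n + 1) • (h - k))
    have e1 : x + (1 / 2 : ℝ) ^ (n + 1) • (h + k) + (1 / 2 : ℝ) ^ (n + 1) • (h - k)
        = x + (1 / 2 : ℝ) ^ n • h := by
      rw [pow_succ]; module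
    have e2 : x + (1 / 2 : ℝ) ^ (n + 1) • (h + k) - (1 / 2 : ℝ) ^ (n + 1) • (h - k)
        = x + (1 / 2 : ℝ) ^ n • k := by
      rw [pow_succ]; module
    have e3 : ‖(1 / 2 : ℝ) ^ (n + 1) • (h - k)‖ ^ (1 + α)
        = (1 / 2 : ℝ) ^ (n + 1) * r ^ (n + 1) * ‖h - k‖ ^ (1 + α) := by
      rw [norm_smul, Real.mul_rpow (norm_nonneg _) (norm_nonneg _), Real.norm_eq_abs,
        abs_of_nonneg (by positivity), Real.rpow_add (by positivity), Real.rpow_one, hr,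
        ← Real.rpow_natCast (_ ^ α), ← Real.rpow_mul (by norm_num), mul_comm α,
        Real.rpow_mul (by norm_num), Real.rpow_natCast]
    rw [e1, e2, e3] at h1
    have e4 : q h n + q k n - q (h + k) (n + 1) = 2 ^ n * (f (x + (1 / 2 : ℝ) ^ n • h) +
        f (x + (1 / 2 : ℝ) ^ n • k) - 2 * f (x + (1 / 2 : ℝ) ^ (n + 1) • (h + k))) := by
      simp only [q, pow_succ (2 : ℝ)]; ring
    rw [e4, abs_mul, abs_of_pos (by positivity : (0 : ℝ) < 2 ^ n)]
    have e5 : (2 : ℝ) ^ n * (1 / 2) ^ n = 1 := by rw [← mul_pow]; norm_num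
    calc _ ≤ (2 : ℝ) ^ n * (A * ((1 / 2 : ℝ) ^ (n + 1) * r ^ (n + 1) * ‖h - k‖ ^ (1 + α))) := by
          gcongr
      _ = (2 ^ n * (1 / 2) ^ n) * (r / 2) * (A * ‖h - k‖ ^ (1 + α) * r ^ n) := by ring
      _ ≤ 1 * (A * ‖h - k‖ ^ (1 + α) * r ^ n) := by
          rw [e5]; gcongr; linarith
      _ = _ := one_mul _
  have hq0 : ∀ n, q 0 n = 0 := fun n => by simp [q]
  have hdist : ∀ h n, dist (q h n) (q h (n + 1)) ≤ A * ‖h‖ ^ (1 + α) * r ^ n := fun h n => by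
    simpa [Real.dist_eq, hq0] using hq h 0 n
  choose D hD using fun h =>
    cauchySeq_tendsto_of_complete (cauchySeq_of_le_geometric r _ hr1 (hdist h))
  have hadd : ∀ h k, D (h + k) = D h + D k := by
    intro h k
    have h1 := ((hD h).add (hD k)).sub ((tendsto_add_atTop_iff_nat 1).2 (hD (h + k)))
    have h2 : Tendsto (fun n => A * ‖h - k‖ ^ (1 + α) * r ^ n) atTop (𝓝 0) := by
      simpa using (tendsto_pow_atTop_nhds_zero_of_lt_one hr0.le hr1).const_mul
        (A * ‖h - k‖ ^ (1 + α))
    have h3 := tendsto_nhds_unique h1 (squeeze_zero_norm (hq h k) h2)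
    linarith
  have hbound : ∀ h, ‖D h‖ ≤ L * ‖h‖ := by
    intro h
    refine le_of_tendsto (hD h).norm (Eventually.of_forall fun n => ?_)
    have h1 := hL (x + (1 / 2 : ℝ) ^ n • h) x
    rw [add_sub_cancel_left, norm_smul, Real.norm_eq_abs,
      abs_of_pos (by positivity : (0 : ℝ) < (1 / 2) ^ n)] at h1
    rw [Real.norm_eq_abs, abs_mul, abs_of_pos (by positivity : (0 : ℝ) < 2 ^ n)]
    calc _ ≤ (2 : ℝ) ^ n * (L * ((1 / 2) ^ n * ‖h‖)) := by gcongr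
      _ = (2 * (1 / 2)) ^ n * (L * ‖h‖) := by rw [mul_pow]; ring
      _ = _ := by norm_num
  let D₀ : X →+ ℝ := AddMonoidHom.mk' D hadd
  refine ⟨D₀.toRealLinearMap (AddMonoidHomClass.continuous_of_bound D₀ L hbound), fun h => ?_⟩
  have h1 := dist_le_of_le_geometric_of_tendsto₀ r _ hr1 (hdist h) (hD h)
  have h2 : q h 0 = f (x + h) - f x := by simp [q]
  rw [Real.dist_eq, h2] at h1
  exact h1.trans_eq (by ring)

/-- Uniform linear approximations of order `1 + α` make a function `C^{1,α}`. -/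
lemma differentiable_holder_of_clm_approx {X : Type*} [NormedAddCommGroup X] [NormedSpace ℝ X]
    {α B : ℝ} (hα : α ∈ Ioc (0 : ℝ) 1) (hB : 0 ≤ B) {f : X → ℝ} {D : X → X →L[ℝ] ℝ}
    (hD : ∀ x h, |f (x + h) - f x - D x h| ≤ B * ‖h‖ ^ (1 + α)) :
    Differentiable ℝ f ∧ ∀ x y, ‖fderiv ℝ f x - fderiv ℝ f y‖ ≤ 6 * B * ‖x - y‖ ^ α := by
  have hder : ∀ x, HasFDerivAt f (D x) x := by
    intro x
    rw [hasFDerivAt_iff_isLittleO_nhds_zero]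
    refine Asymptotics.IsBigO.trans_isLittleO (g := fun h : X => ‖h‖ ^ (1 + α))
      (Asymptotics.IsBigO.of_bound B (Eventually.of_forall fun h => ?_)) ?_
    · rw [Real.norm_of_nonneg (by positivity : 0 ≤ ‖h‖ ^ (1 + α))]
      exact hD x h
    · rw [Asymptotics.isLittleO_iff]
      intro c hc
      have : Tendsto (fun h : X => ‖h‖ ^ α) (𝓝 0) (𝓝 0) := by
        have h1 : Continuous fun h : X => ‖h‖ ^ α :=
          continuous_norm.rpow_const fun _ => Or.inr hα.1.le
        simpa [Real.zero_rpow hα.1.ne'] using h1.tendsto 0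
      filter_upwards [this.eventually_le_const hc] with h hh
      rw [Real.norm_of_nonneg (by positivity), Real.rpow_one_add' (norm_nonneg _)
        (by linarith [hα.1]), mul_comm]
      gcongr
  refine ⟨fun x => (hder x).differentiableAt, fun x y => ?_⟩
  rw [(hder x).fderiv, (hder y).fderiv]
  rcases eq_or_ne x y with rfl | hxy
  · simp only [sub_self, norm_zero]; positivity
  have hs : 0 < ‖x - y‖ := norm_pos_iff.2 (sub_ne_zero.2 hxy)
  set s := ‖x - y‖ with hs_def
  refine ContinuousLinearMap.opNorm_le_of_unit_norm (by positivity) fun h hh => ?_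
  have hyx : ‖y - x‖ = s := norm_sub_rev y x
  have hsh : ‖s • h‖ = s := by rw [norm_smul, hh, mul_one, Real.norm_of_nonneg hs.le]
  have h1 := hD x (y - x)
  have h2 := hD x (y - x + s • h)
  have h3 := hD y (s • h)
  have h4 : ‖y - x + s • h‖ ^ (1 + α) ≤ 4 * s ^ (1 + α) := by
    calc ‖y - x + s • h‖ ^ (1 + α) ≤ (2 * s) ^ (1 + α) := by
          gcongr
          · linarith [hα.1]
          · exact (norm_add_le _ _).trans_eq (by rw [hyx, hsh, two_mul])
      _ = 2 ^ (1 + α) * s ^ (1 + α) := Real.mul_rpow (by norm_num) hs.le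
      _ ≤ 2 ^ (2 : ℝ) * s ^ (1 + α) := by
          gcongr
          · norm_num
          · linarith [hα.2]
      _ = _ := by norm_num
  have h5 := mul_le_mul_of_nonneg_left h4 hB
  rw [add_sub_cancel, hyx] at h1
  rw [← add_assoc, add_sub_cancel, map_add] at h2
  rw [hsh] at h3
  have h6 : |(D x - D y) (s • h)| ≤ 6 * B * s ^ (1 + α) := by
    rw [abs_le] at h1 h2 h3 ⊢
    rw [sub_apply]
    constructor <;> linarith
  rw [map_smul, smul_eq_mul, abs_mul, abs_of_pos hs, Real.rpow_one_add' hs.le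
    (by linarith [hα.1])] at h6
  rw [Real.norm_eq_abs]
  exact le_of_mul_le_mul_left (h6.trans_eq (by ring)) hs

theorem lipschitz_C1alpha_uniform_approx (α C : ℝ) (hα : α ∈ Ioc (0:ℝ) 1) (hC : 0 < C) :
    ∃ κ : ℝ, 1 ≤ κ ∧
      ∀ (X : Type) [NormedAddCommGroup X] [NormedSpace ℝ X] [CompleteSpace X],
        (∀ x h : X,
          ‖x + h‖ ^ (1 + α) + ‖x - h‖ ^ (1 + α) - 2 * ‖x‖ ^ (1 + α) ≤ C * ‖h‖ ^ (1 + α)) →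
        ∀ (g : X → ℝ) (L : ℝ), 0 ≤ L →
          (∀ x y : X, |g x - g y| ≤ L * ‖x - y‖) →
          ∀ ε : ℝ, 0 < ε → ∃ h : X → ℝ,
            (Differentiable ℝ h ∧ ∃ M : ℝ, ∀ x y : X,
              ‖fderiv ℝ h x - fderiv ℝ h y‖ ≤ M * ‖x - y‖ ^ α) ∧
            (∀ x y : X, |h x - h y| ≤ κ * L * ‖x - y‖) ∧
            (∀ x : X, |g x - h x| ≤ ε) := by
  refine ⟨1, le_rfl, fun X _ _ _ hX g L hL0 hg ε hε => ?_⟩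
  obtain ⟨t, ht, hδ⟩ : ∃ t : ℝ, 0 ≤ t ∧
      ∀ r : ℝ, 0 ≤ r → L * r ≤ t * r ^ (1 + α) + ε / 2 := by
    have hr₀ : 0 < ε / 2 / (L + 1) := by positivity
    set r₀ := ε / 2 / (L + 1) with hr₀_def
    refine ⟨L / r₀ ^ α, by positivity, fun r hr => ?_⟩
    rcases le_total r r₀ with h | h
    · have h1 : L * r ≤ (L + 1) * r₀ := by gcongr; linarith
      have h2 : (L + 1) * r₀ = ε / 2 := by rw [hr₀_def]; field_simp
      have h3 : 0 ≤ L / r₀ ^ α * r ^ (1 + α) := by positivity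
      linarith
    · have h1 : L * r ≤ L / r₀ ^ α * r ^ (1 + α) := by
        rw [Real.rpow_one_add' hr (by linarith [hα.1])]
        calc L * r = L / r₀ ^ α * (r * r₀ ^ α) := by field_simp
          _ ≤ _ := by gcongr; exact hα.1.le
      linarith
  have hp : 1 + α ≠ 0 := by linarith [hα.1]
  obtain ⟨v, hgv, hvg, hv, hvL⟩ := exists_semiconcave_approx ht hX hp (g := g)
    (fun x y => by linarith [le_abs_self (g x - g y), hg x y]) hδ
  obtain ⟨u, hgu, hug, hu, -⟩ := exists_semiconcave_approx ht hX hp (g := fun x => -g x)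
    (fun x y => by linarith [neg_abs_le (g x - g y), hg x y]) hδ
  obtain ⟨f, huf, hfv, hf, hfL⟩ := exists_between_of_semiconvex_semiconcave
    (u := fun x => -u x - ε) (v := v) (ω := fun h => t * C * ‖h‖ ^ (1 + α))
    (fun x => by linarith [hgu x, hgv x]) (fun x h => by linarith [hu x h]) hv hvL
  have hfL' : ∀ x y, |f x - f y| ≤ L * ‖x - y‖ := fun x y => by
    have h1 := hfL x y
    have h2 := hfL y x
    rw [norm_sub_rev] at h2
    rw [abs_le]
    constructor <;> linarith
  have hA : 0 ≤ t * C := by positivity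
  choose D hD using exists_clm_approx_of_second_difference hα.1 hA hf hfL'
  have hB : 0 ≤ t * C / (1 - (1 / 2 : ℝ) ^ α) := div_nonneg hA
    (sub_nonneg.2 (Real.rpow_le_one (by norm_num) (by norm_num) hα.1.le))
  obtain ⟨hdiff, hhol⟩ := differentiable_holder_of_clm_approx hα hB hD
  refine ⟨f, ⟨hdiff, _, hhol⟩, fun x y => by simpa using hfL' x y, fun x => ?_⟩
  rw [abs_le]
  constructor <;> linarith [huf x, hfv x, hvg x, hug x]
end
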